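/- Let 0<β<∞, let u be holomorphic on 𝔻 and φ a holomorphic self-map of 𝔻, and suppose uC_φ maps the Bloch space B = B^1 boundedly into Z_β. Then there exist constants c, C > 0 depending only on β (not on u and φ) such that c·M ≤ ‖uC_φ‖_e ≤ C·M, where ‖uC_φ‖_e is the essential norm of uC_φ : B → Z_β and M = max{ limsup_{n→∞} (n+1) ‖(2u'φ' + uφ'')·φ^n‖_{ν_β}, limsup_{n→∞} (n+1)² ‖u·(φ')²·φ^n‖_{ν_β}, limsup_{n→∞} (log n) ‖u''·φ^n‖_{ν_β} }. -/

import Mathlib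

open Complex Filter Set

noncomputable section

/-- The open unit disk in `ℂ`. -/
def unitDisk : Set ℂ := Metric.ball 0 1

/-- The weighted sup-norm `‖g‖_{ν_γ} = sup_{z ∈ 𝔻} (1-|z|²)^γ |g(z)|`. -/
def wnorm (γ : ℝ) (g : ℂ → ℂ) : ℝ :=
  sSup ((fun z => (1 - ‖z‖ ^ 2) ^ γ * ‖g z‖) '' unitDisk)

/-- Membership in the weighted Banach space `H^∞_{ν_β}`. -/
def MemWeighted (β : ℝ) (g : ℂ → ℂ) : Prop :=
  DifferentiableOn ℂ g unitDisk ∧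
    BddAbove ((fun z => (1 - ‖z‖ ^ 2) ^ β * ‖g z‖) '' unitDisk)

/-- Membership in the Bloch type space `B^α`. -/
def MemBloch (α : ℝ) (f : ℂ → ℂ) : Prop :=
  DifferentiableOn ℂ f unitDisk ∧
    BddAbove ((fun z => (1 - ‖z‖ ^ 2) ^ α * ‖deriv f z‖) '' unitDisk)

/-- The Bloch type norm `‖f‖_{B^α} = |f(0)| + sup_{z∈𝔻}(1-|z|²)^α |f'(z)|`. -/
def blochNorm (α : ℝ) (f : ℂ → ℂ) : ℝ :=
  ‖f 0‖ + wnorm α (deriv f)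

/-- Membership in the Zygmund type space `Z_β`. -/
def MemZygmund (β : ℝ) (f : ℂ → ℂ) : Prop :=
  DifferentiableOn ℂ f unitDisk ∧
    BddAbove ((fun z => (1 - ‖z‖ ^ 2) ^ β * ‖deriv (deriv f) z‖) '' unitDisk)

/-- The Zygmund type norm `‖f‖_{Z_β} = |f(0)| + |f'(0)| + sup_{z∈𝔻}(1-|z|²)^β |f''(z)|`. -/
def zygNorm (β : ℝ) (f : ℂ → ℂ) : ℝ :=
  ‖f 0‖ + ‖deriv f 0‖ + wnorm β (deriv (deriv f))

/-- The weighted composition operator `uC_φ f = u · (f ∘ φ)`. -/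
def wcomp (u φ f : ℂ → ℂ) : ℂ → ℂ := fun z => u z * f (φ z)

/-- `uC_φ` maps `B^α` boundedly into `Z_β`. -/
def BoundedBlochToZygmund (α β : ℝ) (u φ : ℂ → ℂ) : Prop :=
  (∀ f, MemBloch α f → MemZygmund β (wcomp u φ f)) ∧
    ∃ C > 0, ∀ f, MemBloch α f → zygNorm β (wcomp u φ f) ≤ C * blochNorm α f

/-- `uC_φ` maps `B^α` boundedly into `H^∞_{ν_β}`. -/
def BoundedBlochToWeighted (α β : ℝ) (u φ : ℂ → ℂ) : Prop :=
  (∀ f, MemBloch α f → MemWeighted β (wcomp u φ f)) ∧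
    ∃ C > 0, ∀ f, MemBloch α f → wnorm β (wcomp u φ f) ≤ C * blochNorm α f

/-- `uC_φ : B^α → Z_β` is compact: it is bounded and maps bounded sets of `B^α` to
totally bounded (equivalently, since `Z_β` is complete, relatively compact) subsets
of `Z_β`. -/
def CompactBlochToZygmund (α β : ℝ) (u φ : ℂ → ℂ) : Prop :=
  BoundedBlochToZygmund α β u φ ∧
    ∀ r : ℝ, ∀ ε : ℝ, 0 < ε → ∃ T : Finset (ℂ → ℂ),
      (∀ g ∈ T, MemZygmund β g) ∧
      ∀ f, MemBloch α f → blochNorm α f ≤ r →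
        ∃ g ∈ T, zygNorm β (fun z => wcomp u φ f z - g z) ≤ ε

/-- `uC_φ : B^α → H^∞_{ν_β}` is compact: it is bounded and maps bounded sets of `B^α`
to totally bounded (equivalently, relatively compact) subsets of `H^∞_{ν_β}`. -/
def CompactBlochToWeighted (α β : ℝ) (u φ : ℂ → ℂ) : Prop :=
  BoundedBlochToWeighted α β u φ ∧
    ∀ r : ℝ, ∀ ε : ℝ, 0 < ε → ∃ T : Finset (ℂ → ℂ),
      (∀ g ∈ T, MemWeighted β g) ∧
      ∀ f, MemBloch α f → blochNorm α f ≤ r →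
        ∃ g ∈ T, wnorm β (fun z => wcomp u φ f z - g z) ≤ ε

/-- A compact (linear, bounded, with totally bounded image of the unit ball) operator
from the subspace of `B^α` cut out by the predicate `P` into `Z_β`. -/
def IsCompactOpToZygmund (α β : ℝ) (P : (ℂ → ℂ) → Prop) (K : (ℂ → ℂ) → ℂ → ℂ) : Prop :=
  (∀ f g, P f → P g → ∀ a b : ℂ,
      K (fun z => a * f z + b * g z) = fun z => a * K f z + b * K g z) ∧
  (∀ f, P f → MemZygmund β (K f)) ∧
  (∃ C, ∀ f, P f → zygNorm β (K f) ≤ C * blochNorm α f) ∧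
  (∀ ε : ℝ, 0 < ε → ∃ T : Finset (ℂ → ℂ), (∀ g ∈ T, MemZygmund β g) ∧
      ∀ f, P f → blochNorm α f ≤ 1 → ∃ g ∈ T, zygNorm β (fun z => K f z - g z) ≤ ε)

/-- The essential norm of `uC_φ`, as an operator from the subspace of `B^α` cut out by
the predicate `P` into `Z_β`: the distance to the compact operators, the operator norm
being the supremum over the unit ball. -/
def essNormZ (α β : ℝ) (P : (ℂ → ℂ) → Prop) (u φ : ℂ → ℂ) : ℝ :=
  sInf {r | ∃ K, IsCompactOpToZygmund α β P K ∧
    r = sSup {s | ∃ f, P f ∧ blochNorm α f ≤ 1 ∧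
          s = zygNorm β (fun z => wcomp u φ f z - K f z)}}

/-- A compact (linear, bounded, with totally bounded image of the unit ball) operator
from `B^α` into `H^∞_{ν_β}`. -/
def IsCompactOpToWeighted (α β : ℝ) (K : (ℂ → ℂ) → ℂ → ℂ) : Prop :=
  (∀ f g, MemBloch α f → MemBloch α g → ∀ a b : ℂ,
      K (fun z => a * f z + b * g z) = fun z => a * K f z + b * K g z) ∧
  (∀ f, MemBloch α f → MemWeighted β (K f)) ∧
  (∃ C, ∀ f, MemBloch α f → wnorm β (K f) ≤ C * blochNorm α f) ∧
  (∀ ε : ℝ, 0 < ε → ∃ T : Finset (ℂ → ℂ), (∀ g ∈ T, MemWeighted β g) ∧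
      ∀ f, MemBloch α f → blochNorm α f ≤ 1 → ∃ g ∈ T, wnorm β (fun z => K f z - g z) ≤ ε)

/-- The essential norm of `uC_φ : B^α → H^∞_{ν_β}`. -/
def essNormW (α β : ℝ) (u φ : ℂ → ℂ) : ℝ :=
  sInf {r | ∃ K, IsCompactOpToWeighted α β K ∧
    r = sSup {s | ∃ f, MemBloch α f ∧ blochNorm α f ≤ 1 ∧
          s = wnorm β (fun z => wcomp u φ f z - K f z)}}

/-- `limsup_{|φ(z)|→1} F(z) = lim_{s→1⁻} sup {F z : z ∈ 𝔻, |φ z| > s}`.  Since the inner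
supremum is nonincreasing in `s`, the limit equals the infimum over `s ∈ [0,1)`; note
that `Real.sSup ∅ = 0`, matching the convention that the value is `0` when
`{z : |φ z| > s}` is empty for some `s < 1`. -/
def phiLimsup (φ : ℂ → ℂ) (F : ℂ → ℝ) : ℝ :=
  sInf ((fun s => sSup {y | ∃ z ∈ unitDisk, s < ‖φ z‖ ∧ y = F z}) '' Set.Ico (0:ℝ) 1)

open scoped Topology

lemma mem_unitDisk {z : ℂ} : z ∈ unitDisk ↔ ‖z‖ < 1 := by
  simp [unitDisk]

lemma isOpen_unitDisk : IsOpen unitDisk := Metric.isOpen_ball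

lemma unitDisk_mem_nhds {z : ℂ} (hz : ‖z‖ < 1) : unitDisk ∈ 𝓝 z :=
  isOpen_unitDisk.mem_nhds (mem_unitDisk.2 hz)

lemma one_sub_norm_sq_pos {z : ℂ} (hz : ‖z‖ < 1) : 0 < 1 - ‖z‖ ^ 2 := by
  nlinarith [norm_nonneg z]

lemma weight_pos (γ : ℝ) {z : ℂ} (hz : ‖z‖ < 1) : 0 < (1 - ‖z‖ ^ 2) ^ γ :=
  Real.rpow_pos_of_pos (one_sub_norm_sq_pos hz) γ

lemma weighted_le_wnorm {γ : ℝ} {g : ℂ → ℂ}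
    (h : BddAbove ((fun z => (1 - ‖z‖ ^ 2) ^ γ * ‖g z‖) '' unitDisk)) {z : ℂ} (hz : ‖z‖ < 1) :
    (1 - ‖z‖ ^ 2) ^ γ * ‖g z‖ ≤ wnorm γ g :=
  le_csSup h ⟨z, mem_unitDisk.2 hz, rfl⟩

lemma wnorm_le_of_forall {γ C : ℝ} {g : ℂ → ℂ}
    (h : ∀ z : ℂ, ‖z‖ < 1 → (1 - ‖z‖ ^ 2) ^ γ * ‖g z‖ ≤ C) : wnorm γ g ≤ C := by
  refine csSup_le ⟨_, 0, mem_unitDisk.2 (by simp), rfl⟩ ?_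
  rintro _ ⟨z, hz, rfl⟩
  exact h z (mem_unitDisk.1 hz)

lemma bddAbove_weighted_of_forall {γ C : ℝ} {g : ℂ → ℂ}
    (h : ∀ z : ℂ, ‖z‖ < 1 → (1 - ‖z‖ ^ 2) ^ γ * ‖g z‖ ≤ C) :
    BddAbove ((fun z => (1 - ‖z‖ ^ 2) ^ γ * ‖g z‖) '' unitDisk) := by
  refine ⟨C, ?_⟩
  rintro _ ⟨z, hz, rfl⟩
  exact h z (mem_unitDisk.1 hz)

lemma wnorm_nonneg (γ : ℝ) (g : ℂ → ℂ) : 0 ≤ wnorm γ g := by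
  refine Real.sSup_nonneg ?_
  rintro _ ⟨z, hz, rfl⟩
  exact mul_nonneg (weight_pos γ (mem_unitDisk.1 hz)).le (norm_nonneg _)

lemma blochNorm_nonneg (α : ℝ) (f : ℂ → ℂ) : 0 ≤ blochNorm α f :=
  add_nonneg (norm_nonneg _) (wnorm_nonneg _ _)

lemma zygNorm_nonneg (β : ℝ) (f : ℂ → ℂ) : 0 ≤ zygNorm β f :=
  add_nonneg (add_nonneg (norm_nonneg _) (norm_nonneg _)) (wnorm_nonneg _ _)

lemma differentiableAt_of_unitDisk {f : ℂ → ℂ} (hf : DifferentiableOn ℂ f unitDisk) {z : ℂ}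
    (hz : ‖z‖ < 1) : DifferentiableAt ℂ f z :=
  hf.differentiableAt (unitDisk_mem_nhds hz)

lemma deriv_linear_comb {f g : ℂ → ℂ} (hf : DifferentiableOn ℂ f unitDisk)
    (hg : DifferentiableOn ℂ g unitDisk) (a b : ℂ) {z : ℂ} (hz : ‖z‖ < 1) :
    deriv (fun w => a * f w + b * g w) z = a * deriv f z + b * deriv g z :=
  (((differentiableAt_of_unitDisk hf hz).hasDerivAt.const_mul a).add
    ((differentiableAt_of_unitDisk hg hz).hasDerivAt.const_mul b)).deriv

lemma deriv_deriv_linear_comb {f g : ℂ → ℂ} (hf : DifferentiableOn ℂ f unitDisk)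
    (hg : DifferentiableOn ℂ g unitDisk) (a b : ℂ) {z : ℂ} (hz : ‖z‖ < 1) :
    deriv (deriv (fun w => a * f w + b * g w)) z =
      a * deriv (deriv f) z + b * deriv (deriv g) z := by
  rw [← deriv_linear_comb (hf.deriv isOpen_unitDisk) (hg.deriv isOpen_unitDisk) a b hz]
  refine Filter.EventuallyEq.deriv_eq ?_
  filter_upwards [unitDisk_mem_nhds hz] with w hw
  exact deriv_linear_comb hf hg a b (mem_unitDisk.1 hw)

lemma weighted_linear_comb_le {γ : ℝ} {f g h : ℂ → ℂ} {a b : ℂ}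
    (hf : BddAbove ((fun z => (1 - ‖z‖ ^ 2) ^ γ * ‖f z‖) '' unitDisk))
    (hg : BddAbove ((fun z => (1 - ‖z‖ ^ 2) ^ γ * ‖g z‖) '' unitDisk))
    (hh : ∀ z : ℂ, ‖z‖ < 1 → h z = a * f z + b * g z) {z : ℂ} (hz : ‖z‖ < 1) :
    (1 - ‖z‖ ^ 2) ^ γ * ‖h z‖ ≤ ‖a‖ * wnorm γ f + ‖b‖ * wnorm γ g := by
  have h1 := weighted_le_wnorm hf hz
  have h2 := weighted_le_wnorm hg hz
  have hw := (weight_pos γ hz).le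
  calc (1 - ‖z‖ ^ 2) ^ γ * ‖h z‖
      ≤ (1 - ‖z‖ ^ 2) ^ γ * (‖a‖ * ‖f z‖ + ‖b‖ * ‖g z‖) := by
        rw [hh z hz, ← norm_mul, ← norm_mul]
        gcongr
        exact norm_add_le _ _
    _ = ‖a‖ * ((1 - ‖z‖ ^ 2) ^ γ * ‖f z‖) + ‖b‖ * ((1 - ‖z‖ ^ 2) ^ γ * ‖g z‖) := by ring
    _ ≤ _ := by gcongr

lemma DifferentiableOn.linear_comb {f g : ℂ → ℂ} (hf : DifferentiableOn ℂ f unitDisk)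
    (hg : DifferentiableOn ℂ g unitDisk) (a b : ℂ) :
    DifferentiableOn ℂ (fun w => a * f w + b * g w) unitDisk :=
  (hf.const_mul a).add (hg.const_mul b)

lemma MemBloch.linear_comb {α : ℝ} {f g : ℂ → ℂ} (hf : MemBloch α f) (hg : MemBloch α g)
    (a b : ℂ) : MemBloch α (fun w => a * f w + b * g w) :=
  ⟨hf.1.linear_comb hg.1 a b, bddAbove_weighted_of_forall fun _ hz =>
    weighted_linear_comb_le hf.2 hg.2 (fun _ hw => deriv_linear_comb hf.1 hg.1 a b hw) hz⟩

lemma blochNorm_linear_comb_le {α : ℝ} {f g : ℂ → ℂ} (hf : MemBloch α f) (hg : MemBloch α g)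
    (a b : ℂ) :
    blochNorm α (fun w => a * f w + b * g w) ≤ ‖a‖ * blochNorm α f + ‖b‖ * blochNorm α g := by
  have h1 : wnorm α (deriv (fun w => a * f w + b * g w)) ≤
      ‖a‖ * wnorm α (deriv f) + ‖b‖ * wnorm α (deriv g) :=
    wnorm_le_of_forall fun _ hz =>
      weighted_linear_comb_le hf.2 hg.2 (fun _ hw => deriv_linear_comb hf.1 hg.1 a b hw) hz
  have h2 : ‖a * f 0 + b * g 0‖ ≤ ‖a‖ * ‖f 0‖ + ‖b‖ * ‖g 0‖ := by
    rw [← norm_mul, ← norm_mul]; exact norm_add_le _ _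
  simp only [blochNorm]
  linarith

lemma MemZygmund.linear_comb {β : ℝ} {f g : ℂ → ℂ} (hf : MemZygmund β f) (hg : MemZygmund β g)
    (a b : ℂ) : MemZygmund β (fun w => a * f w + b * g w) :=
  ⟨hf.1.linear_comb hg.1 a b, bddAbove_weighted_of_forall fun _ hz =>
    weighted_linear_comb_le hf.2 hg.2 (fun _ hw => deriv_deriv_linear_comb hf.1 hg.1 a b hw) hz⟩

lemma zygNorm_linear_comb_le {β : ℝ} {f g : ℂ → ℂ} (hf : MemZygmund β f) (hg : MemZygmund β g)
    (a b : ℂ) :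
    zygNorm β (fun w => a * f w + b * g w) ≤ ‖a‖ * zygNorm β f + ‖b‖ * zygNorm β g := by
  have h1 : wnorm β (deriv (deriv (fun w => a * f w + b * g w))) ≤
      ‖a‖ * wnorm β (deriv (deriv f)) + ‖b‖ * wnorm β (deriv (deriv g)) :=
    wnorm_le_of_forall fun _ hz =>
      weighted_linear_comb_le hf.2 hg.2 (fun _ hw => deriv_deriv_linear_comb hf.1 hg.1 a b hw) hz
  have h2 : ‖a * f 0 + b * g 0‖ ≤ ‖a‖ * ‖f 0‖ + ‖b‖ * ‖g 0‖ := by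
    rw [← norm_mul, ← norm_mul]; exact norm_add_le _ _
  have h3 : ‖deriv (fun w => a * f w + b * g w) 0‖ ≤ ‖a‖ * ‖deriv f 0‖ + ‖b‖ * ‖deriv g 0‖ := by
    rw [deriv_linear_comb hf.1 hg.1 a b (by simp), ← norm_mul, ← norm_mul]
    exact norm_add_le _ _
  simp only [zygNorm]
  linarith

lemma MemZygmund.sub {β : ℝ} {f g : ℂ → ℂ} (hf : MemZygmund β f) (hg : MemZygmund β g) :
    MemZygmund β (fun w => f w - g w) := by
  simpa [sub_eq_add_neg] using hf.linear_comb hg 1 (-1)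

lemma zygNorm_sub_le {β : ℝ} {f g : ℂ → ℂ} (hf : MemZygmund β f) (hg : MemZygmund β g) :
    zygNorm β (fun w => f w - g w) ≤ zygNorm β f + zygNorm β g := by
  simpa [sub_eq_add_neg] using zygNorm_linear_comb_le hf hg 1 (-1)

lemma MemBloch.sub {α : ℝ} {f g : ℂ → ℂ} (hf : MemBloch α f) (hg : MemBloch α g) :
    MemBloch α (fun w => f w - g w) := by
  simpa [sub_eq_add_neg] using hf.linear_comb hg 1 (-1)

lemma blochNorm_sub_le {α : ℝ} {f g : ℂ → ℂ} (hf : MemBloch α f) (hg : MemBloch α g) :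
    blochNorm α (fun w => f w - g w) ≤ blochNorm α f + blochNorm α g := by
  simpa [sub_eq_add_neg] using blochNorm_linear_comb_le hf hg 1 (-1)

lemma weighted_deriv_deriv_le_zygNorm {β : ℝ} {f : ℂ → ℂ} (hf : MemZygmund β f) {z : ℂ}
    (hz : ‖z‖ < 1) : (1 - ‖z‖ ^ 2) ^ β * ‖deriv (deriv f) z‖ ≤ zygNorm β f := by
  have := weighted_le_wnorm hf.2 hz
  simp only [zygNorm]
  linarith [norm_nonneg (f 0), norm_nonneg (deriv f 0)]

lemma memZygmund_zero (β : ℝ) : MemZygmund β (fun _ => 0) :=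
  ⟨differentiableOn_const _, bddAbove_weighted_of_forall (C := 0) fun z _ => by simp⟩

lemma zygNorm_zero (β : ℝ) : zygNorm β (fun _ => 0) = 0 := by
  refine le_antisymm ?_ (zygNorm_nonneg _ _)
  have : wnorm β (deriv (deriv (fun _ : ℂ => (0 : ℂ)))) ≤ 0 := wnorm_le_of_forall fun z _ => by simp
  simpa [zygNorm] using this

lemma MemZygmund.sum {β : ℝ} {e : ℕ → ℂ → ℂ} (he : ∀ k, MemZygmund β (e k)) (c : ℕ → ℂ) (N : ℕ) :
    MemZygmund β (fun w => ∑ k ∈ Finset.range N, c k * e k w) := by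
  induction N with
  | zero => simpa using memZygmund_zero β
  | succ n ih =>
    simp only [Finset.sum_range_succ]
    simpa using ih.linear_comb (he n) 1 (c n)

lemma zygNorm_sum_le {β : ℝ} {e : ℕ → ℂ → ℂ} (he : ∀ k, MemZygmund β (e k)) (c : ℕ → ℂ) (N : ℕ) :
    zygNorm β (fun w => ∑ k ∈ Finset.range N, c k * e k w) ≤
      ∑ k ∈ Finset.range N, ‖c k‖ * zygNorm β (e k) := by
  induction N with
  | zero => simpa using (zygNorm_zero β).le
  | succ n ih =>
    simp only [Finset.sum_range_succ]
    have := zygNorm_linear_comb_le (MemZygmund.sum he c n) (he n) 1 (c n)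
    simp only [one_mul, norm_one] at this
    linarith

lemma norm_deriv_le_of_forall_norm_le {f : ℂ → ℂ} {R : ℝ}
    (hf : DifferentiableOn ℂ f (Metric.ball 0 R)) {z : ℂ} {ρ C : ℝ} (hρ : 0 < ρ)
    (hz : ‖z‖ + ρ < R) (hC : ∀ w : ℂ, ‖w‖ ≤ ‖z‖ + ρ → ‖f w‖ ≤ C) : ‖deriv f z‖ ≤ C / ρ := by
  have key : ∀ w ∈ Metric.closedBall z ρ, ‖w‖ ≤ ‖z‖ + ρ := fun w hw => by
    have h1 : ‖w - z‖ ≤ ρ := by simpa [dist_eq_norm] using hw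
    have h2 : ‖w‖ ≤ ‖z‖ + ‖w - z‖ := by simpa using norm_add_le z (w - z)
    linarith
  refine Complex.norm_deriv_le_of_forall_mem_sphere_norm_le hρ ?_
    fun w hw => hC w (key w (Metric.sphere_subset_closedBall hw))
  refine DifferentiableOn.diffContOnCl (hf.mono ?_)
  rw [closure_ball z hρ.ne']
  intro w hw
  have := key w hw
  simp only [Metric.mem_ball, dist_zero_right]
  linarith

lemma weighted_deriv_le_blochNorm {f : ℂ → ℂ} (hf : MemBloch 1 f) {z : ℂ} (hz : ‖z‖ < 1) :
    (1 - ‖z‖ ^ 2) * ‖deriv f z‖ ≤ blochNorm 1 f := by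
  have := weighted_le_wnorm hf.2 hz
  rw [Real.rpow_one] at this
  simp only [blochNorm]
  linarith [norm_nonneg (f 0)]

lemma MemBloch.norm_deriv_le {f : ℂ → ℂ} (hf : MemBloch 1 f) {z : ℂ} (hz : ‖z‖ < 1) :
    ‖deriv f z‖ ≤ blochNorm 1 f / (1 - ‖z‖) := by
  have h := weighted_deriv_le_blochNorm hf hz
  rw [le_div_iff₀ (by linarith)]
  nlinarith [mul_nonneg (norm_nonneg z) (norm_nonneg (deriv f z)),
    mul_nonneg (mul_nonneg (norm_nonneg z) (norm_nonneg (deriv f z))) (sub_nonneg.2 hz.le)]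

lemma MemBloch.norm_le {f : ℂ → ℂ} (hf : MemBloch 1 f) {z : ℂ} (hz : ‖z‖ < 1) :
    ‖f z‖ ≤ blochNorm 1 f * (1 - Real.log (1 - ‖z‖)) := by
  have hlt : ∀ t ∈ Set.Icc (0 : ℝ) 1, t * ‖z‖ < 1 := fun t ht => by
    nlinarith [norm_nonneg z, ht.1, ht.2]
  have hnorm : ∀ t ∈ Set.Icc (0 : ℝ) 1, ‖(t : ℂ) * z‖ = t * ‖z‖ := fun t ht => by
    rw [norm_mul, Complex.norm_real, Real.norm_of_nonneg ht.1]
  have hF : ∀ t ∈ Set.Icc (0 : ℝ) 1,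
      HasDerivAt (fun s : ℝ => f ((s : ℂ) * z)) (deriv f ((t : ℂ) * z) * z) t := fun t ht => by
    have h1 : HasDerivAt f (deriv f ((t : ℂ) * z)) ((t : ℂ) * z) :=
      (differentiableAt_of_unitDisk hf.1 (by rw [hnorm t ht]; exact hlt t ht)).hasDerivAt
    have h2 : HasDerivAt (fun s : ℂ => s * z) z (t : ℂ) := by
      simpa using (hasDerivAt_id (t : ℂ)).mul_const z
    exact (HasDerivAt.comp (t : ℂ) h1 h2).comp_ofReal
  have hB : ∀ t ∈ Set.Icc (0 : ℝ) 1,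
      HasDerivAt (fun s : ℝ => blochNorm 1 f * (1 - Real.log (1 - s * ‖z‖)))
        (blochNorm 1 f / (1 - t * ‖z‖) * ‖z‖) t := fun t ht => by
    have h1 : HasDerivAt (fun s : ℝ => 1 - s * ‖z‖) (-‖z‖) t := by
      simpa using ((hasDerivAt_id t).mul_const ‖z‖).const_sub 1
    have h2 := ((h1.log (by linarith [hlt t ht])).const_sub 1).const_mul (blochNorm 1 f)
    refine h2.congr_deriv ?_
    ring
  have key := image_norm_le_of_norm_deriv_right_le_deriv_boundary'
    (f := fun s : ℝ => f ((s : ℂ) * z)) (a := 0) (b := 1)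
    (fun t ht => (hF t ht).continuousAt.continuousWithinAt)
    (fun t ht => (hF t (Set.Ico_subset_Icc_self ht)).hasDerivWithinAt)
    (B := fun s : ℝ => blochNorm 1 f * (1 - Real.log (1 - s * ‖z‖)))
    (by
      have := wnorm_nonneg 1 (deriv f)
      simp only [blochNorm]
      simpa using this)
    (fun t ht => (hB t ht).continuousAt.continuousWithinAt)
    (fun t ht => (hB t (Set.Ico_subset_Icc_self ht)).hasDerivWithinAt)
    (fun t ht => by
      have ht' := Set.Ico_subset_Icc_self ht
      rw [norm_mul]
      have := hf.norm_deriv_le (z := (t : ℂ) * z) (by rw [hnorm t ht']; exact hlt t ht')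
      rw [hnorm t ht'] at this
      gcongr)
    (Set.right_mem_Icc.2 zero_le_one)
  simpa using key

lemma MemBloch.norm_deriv_deriv_le {f : ℂ → ℂ} (hf : MemBloch 1 f) {z : ℂ} (hz : ‖z‖ < 1) :
    ‖deriv (deriv f) z‖ ≤ 4 * blochNorm 1 f / (1 - ‖z‖) ^ 2 := by
  have hN := blochNorm_nonneg 1 f
  have hd : 0 < 1 - ‖z‖ := by linarith
  have := norm_deriv_le_of_forall_norm_le (hf.1.deriv isOpen_unitDisk)
    (ρ := (1 - ‖z‖) / 2) (C := blochNorm 1 f / ((1 - ‖z‖) / 2)) (by linarith) (by linarith)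
    (z := z) fun w hw => by
      refine (hf.norm_deriv_le (by linarith)).trans ?_
      gcongr
      linarith
  refine this.trans (le_of_eq ?_)
  field_simp
  ring

lemma deriv_deriv_wcomp {u φ f : ℂ → ℂ} (hu : DifferentiableOn ℂ u unitDisk)
    (hφ : DifferentiableOn ℂ φ unitDisk) (hmaps : Set.MapsTo φ unitDisk unitDisk)
    (hf : DifferentiableOn ℂ f unitDisk) {z : ℂ} (hz : ‖z‖ < 1) :
    deriv (deriv (wcomp u φ f)) z = deriv (deriv u) z * f (φ z) +
      (2 * deriv u z * deriv φ z + u z * deriv (deriv φ) z) * deriv f (φ z) +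
      u z * deriv φ z ^ 2 * deriv (deriv f) (φ z) := by
  have hφ1 : ∀ {w : ℂ}, ‖w‖ < 1 → ‖φ w‖ < 1 := fun hw =>
    mem_unitDisk.1 (hmaps (mem_unitDisk.2 hw))
  have hcomp : ∀ {g : ℂ → ℂ}, DifferentiableOn ℂ g unitDisk → ∀ {w : ℂ}, ‖w‖ < 1 →
      HasDerivAt (fun x => g (φ x)) (deriv g (φ w) * deriv φ w) w := fun hg _ hw =>
    HasDerivAt.comp _ (differentiableAt_of_unitDisk hg (hφ1 hw)).hasDerivAt
      (differentiableAt_of_unitDisk hφ hw).hasDerivAt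
  have h1 : deriv (wcomp u φ f) =ᶠ[𝓝 z]
      fun w => deriv u w * f (φ w) + u w * (deriv f (φ w) * deriv φ w) := by
    filter_upwards [unitDisk_mem_nhds hz] with w hw
    have hw := mem_unitDisk.1 hw
    exact ((differentiableAt_of_unitDisk hu hw).hasDerivAt.mul (hcomp hf hw)).deriv
  rw [h1.deriv_eq]
  have hu' := differentiableAt_of_unitDisk (hu.deriv isOpen_unitDisk) hz
  have hφ' := differentiableAt_of_unitDisk (hφ.deriv isOpen_unitDisk) hz
  refine ((hu'.hasDerivAt.mul (hcomp hf hz)).add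
    ((differentiableAt_of_unitDisk hu hz).hasDerivAt.mul
      ((hcomp (hf.deriv isOpen_unitDisk) hz).mul hφ'.hasDerivAt))).deriv.trans ?_
  simp only [Pi.mul_apply]
  ring

lemma deriv_wcomp {u φ f : ℂ → ℂ} (hu : DifferentiableOn ℂ u unitDisk)
    (hφ : DifferentiableOn ℂ φ unitDisk) (hmaps : Set.MapsTo φ unitDisk unitDisk)
    (hf : DifferentiableOn ℂ f unitDisk) {z : ℂ} (hz : ‖z‖ < 1) :
    deriv (wcomp u φ f) z = deriv u z * f (φ z) + u z * (deriv f (φ z) * deriv φ z) :=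
  ((differentiableAt_of_unitDisk hu hz).hasDerivAt.mul
    (HasDerivAt.comp _ (differentiableAt_of_unitDisk hf
      (mem_unitDisk.1 (hmaps (mem_unitDisk.2 hz)))).hasDerivAt
      (differentiableAt_of_unitDisk hφ hz).hasDerivAt)).deriv

lemma memBloch_of_forall_norm_deriv_le {f : ℂ → ℂ} (hf : DifferentiableOn ℂ f unitDisk) {C : ℝ}
    (hC : ∀ z : ℂ, ‖z‖ < 1 → (1 - ‖z‖ ^ 2) * ‖deriv f z‖ ≤ C) : MemBloch 1 f :=
  ⟨hf, bddAbove_weighted_of_forall fun z hz => by simpa using hC z hz⟩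

lemma blochNorm_le_of_forall_norm_deriv_le {f : ℂ → ℂ} {C C' : ℝ} (h0 : ‖f 0‖ ≤ C')
    (hC : ∀ z : ℂ, ‖z‖ < 1 → (1 - ‖z‖ ^ 2) * ‖deriv f z‖ ≤ C) : blochNorm 1 f ≤ C' + C :=
  add_le_add h0 (wnorm_le_of_forall fun z hz => by simpa using hC z hz)

lemma memBloch_pow (k : ℕ) : MemBloch 1 (fun z => z ^ k) := by
  refine memBloch_of_forall_norm_deriv_le (differentiableOn_pow k) (C := k) fun z hz => ?_
  have h1 : ‖z‖ ^ (k - 1) ≤ 1 := pow_le_one₀ (norm_nonneg z) hz.le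
  have h2 := one_sub_norm_sq_pos hz
  simp only [deriv_pow_field, norm_mul, norm_pow, Complex.norm_natCast]
  calc (1 - ‖z‖ ^ 2) * (k * ‖z‖ ^ (k - 1)) ≤ 1 * (k * 1) := by
        gcongr
        linarith [sq_nonneg ‖z‖]
    _ = k := by ring

lemma exists_forall_weighted_coeff_le {β : ℝ} {u φ : ℂ → ℂ} (hu : DifferentiableOn ℂ u unitDisk)
    (hφ : DifferentiableOn ℂ φ unitDisk) (hmaps : Set.MapsTo φ unitDisk unitDisk)
    (hb : BoundedBlochToZygmund 1 β u φ) :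
    ∃ M : ℝ, 0 ≤ M ∧ ∀ z : ℂ, ‖z‖ < 1 →
      (1 - ‖z‖ ^ 2) ^ β * ‖deriv (deriv u) z‖ ≤ M ∧
      (1 - ‖z‖ ^ 2) ^ β * ‖2 * deriv u z * deriv φ z + u z * deriv (deriv φ) z‖ ≤ M ∧
      (1 - ‖z‖ ^ 2) ^ β * ‖u z * deriv φ z ^ 2‖ ≤ M := by
  obtain ⟨M, hM⟩ : ∃ M : ℝ, ∀ k ∈ Finset.range 3,
      zygNorm β (wcomp u φ (fun z => z ^ k)) ≤ M :=
    ⟨∑ k ∈ Finset.range 3, zygNorm β (wcomp u φ (fun z => z ^ k)), fun k hk =>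
      Finset.single_le_sum (f := fun k => zygNorm β (wcomp u φ (fun z => z ^ k)))
        (fun i _ => zygNorm_nonneg _ _) hk⟩
  have hM0 : 0 ≤ M := (zygNorm_nonneg _ _).trans (hM 0 (by simp))
  refine ⟨4 * M, by linarith, fun z hz => ?_⟩
  have hφz : ‖φ z‖ < 1 := mem_unitDisk.1 (hmaps (mem_unitDisk.2 hz))
  have key : ∀ k ∈ Finset.range 3,
      (1 - ‖z‖ ^ 2) ^ β * ‖deriv (deriv (wcomp u φ (fun z => z ^ k))) z‖ ≤ M := fun k hk =>
    (weighted_deriv_deriv_le_zygNorm (hb.1 _ (memBloch_pow k)) hz).trans (hM k hk)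
  have h0 := key 0 (by simp)
  have h1 := key 1 (by simp)
  have h2 := key 2 (by simp)
  rw [deriv_deriv_wcomp hu hφ hmaps (differentiableOn_pow _) hz] at h0 h1 h2
  have hd1 : deriv (fun z : ℂ => z ^ 2) = fun z => 2 * z := by
    funext w; simp
  have hd2 : deriv (fun z : ℂ => 2 * z) = fun z => 2 := by
    funext w; simp
  simp only [hd1, hd2] at h2
  simp only [pow_zero, pow_one, deriv_const', deriv_id'', mul_one, mul_zero, add_zero] at h0 h1
  set W := (1 - ‖z‖ ^ 2) ^ β with hW
  have hW0 : 0 ≤ W := (weight_pos β hz).le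
  set A := deriv (deriv u) z
  set B := 2 * deriv u z * deriv φ z + u z * deriv (deriv φ) z
  set D := u z * deriv φ z ^ 2
  set w := φ z
  have hB : W * ‖B‖ ≤ 2 * M := by
    have : ‖B‖ ≤ ‖A * w + B‖ + ‖A‖ := by
      calc ‖B‖ = ‖(A * w + B) - A * w‖ := by ring_nf
        _ ≤ ‖A * w + B‖ + ‖A * w‖ := norm_sub_le _ _
        _ ≤ _ := by
          rw [norm_mul]
          nlinarith [norm_nonneg A, norm_nonneg w]
    nlinarith
  have hD : W * ‖D‖ ≤ 4 * M := by
    have : 2 * ‖D‖ ≤ ‖A * w ^ 2 + B * (2 * w) + D * 2‖ + ‖A‖ + 2 * ‖B‖ := by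
      calc 2 * ‖D‖ = ‖(A * w ^ 2 + B * (2 * w) + D * 2) - A * w ^ 2 - B * (2 * w)‖ := by
            rw [← Complex.norm_two, ← norm_mul]; ring_nf
        _ ≤ ‖A * w ^ 2 + B * (2 * w) + D * 2‖ + ‖A * w ^ 2‖ + ‖B * (2 * w)‖ :=
            (norm_sub_le _ _).trans (add_le_add (norm_sub_le _ _) le_rfl)
        _ ≤ ‖A * w ^ 2 + B * (2 * w) + D * 2‖ + ‖A‖ * 1 + ‖B‖ * (2 * 1) := by
          simp only [norm_mul, norm_pow, Complex.norm_two]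
          gcongr
          exact pow_le_one₀ (norm_nonneg w) hφz.le
        _ = _ := by ring
    nlinarith
  exact ⟨by linarith, by linarith, hD⟩

lemma wcomp_linear_comb (u φ f g : ℂ → ℂ) (a b : ℂ) :
    wcomp u φ (fun z => a * f z + b * g z) =
      fun z => a * wcomp u φ f z + b * wcomp u φ g z := by
  funext z
  simp only [wcomp]
  ring

lemma norm_deriv_le_of_forall_norm_le_div_pow {g : ℂ → ℂ} (hg : DifferentiableOn ℂ g unitDisk)
    {C : ℝ} (hC : 0 ≤ C) (m : ℕ) (h : ∀ w : ℂ, ‖w‖ < 1 → ‖g w‖ ≤ C / (1 - ‖w‖) ^ m) {w : ℂ}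
    (hw : ‖w‖ < 1) : ‖deriv g w‖ ≤ 2 ^ (m + 1) * C / (1 - ‖w‖) ^ (m + 1) := by
  have hd : 0 < 1 - ‖w‖ := by linarith
  have := norm_deriv_le_of_forall_norm_le hg
    (ρ := (1 - ‖w‖) / 2) (C := C / ((1 - ‖w‖) / 2) ^ m) (by linarith) (by linarith)
    (z := w) fun x hx => by
      refine (h x (by linarith)).trans ?_
      gcongr
      linarith
  refine this.trans (le_of_eq ?_)
  rw [div_pow]
  field_simp
  ring

lemma tendsto_deriv_deriv_wcomp {u φ : ℂ → ℂ} (hu : DifferentiableOn ℂ u unitDisk)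
    (hφ : DifferentiableOn ℂ φ unitDisk) (hmaps : Set.MapsTo φ unitDisk unitDisk)
    {f : ℕ → ℂ → ℂ} (hf : ∀ k, DifferentiableOn ℂ (f k) unitDisk) {η : ℕ → ℝ} {m : ℕ}
    (hη : Tendsto η atTop (𝓝 0))
    (h : ∀ k, ∀ w : ℂ, ‖w‖ < 1 → ‖f k w‖ ≤ η k / (1 - ‖w‖) ^ m) {z : ℂ} (hz : ‖z‖ < 1) :
    Tendsto (fun k => deriv (deriv (wcomp u φ (f k))) z) atTop (𝓝 0) := by
  have hη0 : ∀ k, 0 ≤ η k := fun k => (norm_nonneg _).trans (by simpa using h k 0 (by simp))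
  have hw : ‖φ z‖ < 1 := mem_unitDisk.1 (hmaps (mem_unitDisk.2 hz))
  have h1 : ∀ k, ∀ w : ℂ, ‖w‖ < 1 → _ := fun k w hw =>
    norm_deriv_le_of_forall_norm_le_div_pow (hf k) (hη0 k) m (h k) hw
  have h2 : ∀ k, ∀ w : ℂ, ‖w‖ < 1 → _ := fun k w hw =>
    norm_deriv_le_of_forall_norm_le_div_pow ((hf k).deriv isOpen_unitDisk)
      (mul_nonneg (by positivity) (hη0 k)) (m + 1) (h1 k) hw
  have t0 : Tendsto (fun k => f k (φ z)) atTop (𝓝 0) :=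
    squeeze_zero_norm (fun k => h k _ hw) (by simpa using hη.div_const _)
  have t1 : Tendsto (fun k => deriv (f k) (φ z)) atTop (𝓝 0) :=
    squeeze_zero_norm (fun k => h1 k _ hw) (by simpa using (hη.const_mul _).div_const _)
  have t2 : Tendsto (fun k => deriv (deriv (f k)) (φ z)) atTop (𝓝 0) :=
    squeeze_zero_norm (fun k => h2 k _ hw)
      (by simpa using ((hη.const_mul _).const_mul _).div_const _)
  simp only [fun k => deriv_deriv_wcomp hu hφ hmaps (hf k) hz]
  simpa using ((t0.const_mul (deriv (deriv u) z)).add (t1.const_mul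
    (2 * deriv u z * deriv φ z + u z * deriv (deriv φ) z))).add
      (t2.const_mul (u z * deriv φ z ^ 2))

lemma eventually_weighted_deriv_deriv_wcomp_le {β : ℝ} {u φ : ℂ → ℂ}
    (hb : BoundedBlochToZygmund 1 β u φ) {K : (ℂ → ℂ) → ℂ → ℂ}
    (hK : IsCompactOpToZygmund 1 β (MemBloch 1) K) {S : ℝ}
    (hS : ∀ f, MemBloch 1 f → blochNorm 1 f ≤ 1 →
      zygNorm β (fun z => wcomp u φ f z - K f z) ≤ S)
    {f : ℕ → ℂ → ℂ} (hf : ∀ k, MemBloch 1 (f k)) (hf1 : ∀ k, blochNorm 1 (f k) ≤ 1)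
    (hlim : ∀ z : ℂ, ‖z‖ < 1 →
      Tendsto (fun k => deriv (deriv (wcomp u φ (f k))) z) atTop (𝓝 0))
    {ε : ℝ} (hε : 0 < ε) :
    ∀ᶠ k in atTop, ∀ z : ℂ, ‖z‖ < 1 →
      (1 - ‖z‖ ^ 2) ^ β * ‖deriv (deriv (wcomp u φ (f k))) z‖ ≤ 2 * S + ε := by
  obtain ⟨hlin, hmem, -, hcpt⟩ := hK
  obtain ⟨T, hT, hnet⟩ := hcpt (ε / 2) (by positivity)
  choose! τ hτT hτ using fun k => hnet (f k) (hf k) (hf1 k)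
  have hev : ∀ᶠ k in atTop, ∃ᶠ j in atTop, τ j = τ k := by
    have : ∀ t ∈ T, ∀ᶠ k in atTop, τ k = t → ∃ᶠ j in atTop, τ j = t := fun t _ => by
      by_cases h : ∃ᶠ j in atTop, τ j = t
      · exact Eventually.of_forall fun _ _ => h
      · exact (not_frequently.1 h).mono fun k hk hk' => absurd hk' hk
    exact ((Filter.eventually_all_finset T).2 this).mono fun k hk => hk (τ k) (hτT k) rfl
  have hdiff : ∀ k j, τ j = τ k → ∀ z : ℂ, ‖z‖ < 1 →
      (1 - ‖z‖ ^ 2) ^ β * ‖deriv (deriv (wcomp u φ (f k))) z -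
        deriv (deriv (wcomp u φ (f j))) z‖ ≤ 2 * S + ε := by
    intro k j hkj z hz
    set G : ℂ → ℂ := fun z => (1 / 2 : ℂ) * f k z + (-1 / 2 : ℂ) * f j z with hG
    have hGm : MemBloch 1 G := (hf k).linear_comb (hf j) _ _
    have hG1 : blochNorm 1 G ≤ 1 := by
      have := blochNorm_linear_comb_le (hf k) (hf j) (1 / 2 : ℂ) (-1 / 2 : ℂ)
      rw [show ‖(1 / 2 : ℂ)‖ = 1 / 2 by norm_num, show ‖(-1 / 2 : ℂ)‖ = 1 / 2 by norm_num] at this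
      exact this.trans (by linarith [hf1 k, hf1 j])
    have hH := (hb.1 G hGm).sub (hmem G hGm)
    have hKK : MemZygmund β (fun z => K (f k) z - K (f j) z) := (hmem _ (hf k)).sub (hmem _ (hf j))
    have hKn : zygNorm β (fun z => K (f k) z - K (f j) z) ≤ ε := by
      have h1 := zygNorm_sub_le ((hmem _ (hf k)).sub (hT _ (hτT k)))
        ((hmem _ (hf j)).sub (hT _ (hτT k)))
      simp only [sub_sub_sub_cancel_right] at h1
      have h2 := hτ j
      rw [hkj] at h2
      linarith [hτ k]
    have heq : (fun z => 1 * wcomp u φ (f k) z + (-1) * wcomp u φ (f j) z) =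
        fun z => (2 : ℂ) * (wcomp u φ G z - K G z) + 1 * (K (f k) z - K (f j) z) := by
      rw [hG, hlin _ _ (hf k) (hf j), wcomp_linear_comb]
      funext z
      ring
    have hn := zygNorm_linear_comb_le hH hKK 2 1
    rw [← heq] at hn
    have hn2 := weighted_deriv_deriv_le_zygNorm
      ((hb.1 _ (hf k)).linear_comb (hb.1 _ (hf j)) 1 (-1)) hz
    rw [deriv_deriv_linear_comb (hb.1 _ (hf k)).1 (hb.1 _ (hf j)).1 _ _ hz] at hn2
    simp only [one_mul, neg_mul, ← sub_eq_add_neg, norm_one, Complex.norm_two] at hn hn2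
    linarith [hS G hGm hG1]
  filter_upwards [hev] with k hk z hz
  have hl : Tendsto (fun j => (1 - ‖z‖ ^ 2) ^ β * ‖deriv (deriv (wcomp u φ (f k))) z -
        deriv (deriv (wcomp u φ (f j))) z‖) atTop
      (𝓝 ((1 - ‖z‖ ^ 2) ^ β * ‖deriv (deriv (wcomp u φ (f k))) z‖)) := by
    simpa using ((tendsto_const_nhds.sub (hlim z hz)).norm).const_mul _
  exact le_of_tendsto_of_frequently hl (hk.mono fun j hj => hdiff k j hj z hz)

/-- If a family of test functions `g a` in the unit ball of the Bloch space tends to `0` locally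
uniformly as `|a| → 1`, then the second derivative of `uC_φ g_{φ(z)}` at `z` is asymptotically controlled by the distance
from `uC_φ` to any compact operator. -/
lemma exists_forall_weighted_testFunction_le {β : ℝ} {u φ : ℂ → ℂ}
    (hu : DifferentiableOn ℂ u unitDisk) (hφ : DifferentiableOn ℂ φ unitDisk)
    (hmaps : Set.MapsTo φ unitDisk unitDisk)
    (hb : BoundedBlochToZygmund 1 β u φ) {K : (ℂ → ℂ) → ℂ → ℂ}
    (hK : IsCompactOpToZygmund 1 β (MemBloch 1) K) {S : ℝ}
    (hS : ∀ f, MemBloch 1 f → blochNorm 1 f ≤ 1 →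
      zygNorm β (fun z => wcomp u φ f z - K f z) ≤ S)
    {g : ℂ → ℂ → ℂ} (hg : ∀ a : ℂ, ‖a‖ < 1 → MemBloch 1 (g a))
    (hg1 : ∀ a : ℂ, ‖a‖ < 1 → blochNorm 1 (g a) ≤ 1) {η : ℝ → ℝ} {m : ℕ}
    (hη : Tendsto η (𝓝[<] 1) (𝓝 0))
    (hgη : ∀ a w : ℂ, ‖a‖ < 1 → ‖w‖ < 1 → ‖g a w‖ ≤ η ‖a‖ / (1 - ‖w‖) ^ m)
    {ε : ℝ} (hε : 0 < ε) :
    ∃ s < 1, ∀ z : ℂ, ‖z‖ < 1 → s < ‖φ z‖ →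
      (1 - ‖z‖ ^ 2) ^ β * ‖deriv (deriv (wcomp u φ (g (φ z)))) z‖ ≤ 2 * S + ε := by
  by_contra! hcon
  have hs : ∀ k : ℕ, 1 - 1 / ((k : ℝ) + 1) < 1 := fun k => by
    have : 0 < 1 / ((k : ℝ) + 1) := by positivity
    linarith
  choose z hz1 hzs hzb using fun k : ℕ => hcon _ (hs k)
  have hφz : ∀ k, ‖φ (z k)‖ < 1 := fun k => mem_unitDisk.1 (hmaps (mem_unitDisk.2 (hz1 k)))
  have ht : Tendsto (fun k => ‖φ (z k)‖) atTop (𝓝[<] 1) := by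
    refine tendsto_nhdsWithin_iff.2 ⟨?_, Eventually.of_forall hφz⟩
    refine tendsto_of_tendsto_of_tendsto_of_le_of_le ?_ tendsto_const_nhds
      (fun k => (hzs k).le) (fun k => (hφz k).le)
    simpa using (tendsto_one_div_add_atTop_nhds_zero_nat (𝕜 := ℝ)).const_sub 1
  have hev := eventually_weighted_deriv_deriv_wcomp_le hb hK hS (f := fun k => g (φ (z k)))
    (fun k => hg _ (hφz k)) (fun k => hg1 _ (hφz k))
    (fun w hw => tendsto_deriv_deriv_wcomp hu hφ hmaps (fun k => (hg _ (hφz k)).1)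
      (hη.comp ht) (fun k x hx => hgη _ x (hφz k) hx) hw) hε
  obtain ⟨k, hk⟩ := hev.exists
  exact absurd (hk (z k) (hz1 k)) (not_le.2 (hzb k))

lemma one_sub_norm_left_le {a z : ℂ} (hz : ‖z‖ < 1) :
    1 - ‖a‖ ≤ ‖1 - (starRingEnd ℂ) a * z‖ := by
  have h := norm_sub_norm_le (1 : ℂ) ((starRingEnd ℂ) a * z)
  rw [norm_one, norm_mul, RCLike.norm_conj] at h
  nlinarith [norm_nonneg a, norm_nonneg z]

lemma one_sub_norm_right_le {a z : ℂ} (ha : ‖a‖ < 1) :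
    1 - ‖z‖ ≤ ‖1 - (starRingEnd ℂ) a * z‖ := by
  have h := norm_sub_norm_le (1 : ℂ) ((starRingEnd ℂ) a * z)
  rw [norm_one, norm_mul, RCLike.norm_conj] at h
  nlinarith [norm_nonneg a, norm_nonneg z]

lemma norm_one_sub_conj_mul_le {a z : ℂ} (ha : ‖a‖ < 1) (hz : ‖z‖ < 1) :
    ‖1 - (starRingEnd ℂ) a * z‖ ≤ 2 := by
  have h := norm_sub_le (1 : ℂ) ((starRingEnd ℂ) a * z)
  rw [norm_one, norm_mul, RCLike.norm_conj] at h
  nlinarith [norm_nonneg a, norm_nonneg z]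

lemma one_sub_conj_mul_ne_zero {a z : ℂ} (ha : ‖a‖ < 1) (hz : ‖z‖ < 1) :
    1 - (starRingEnd ℂ) a * z ≠ 0 := by
  have := one_sub_norm_left_le (a := a) hz
  exact norm_pos_iff.1 (by linarith)

lemma one_sub_conj_mul_self (a : ℂ) : 1 - (starRingEnd ℂ) a * a = ((1 - ‖a‖ ^ 2 : ℝ) : ℂ) := by
  rw [Complex.conj_mul']
  push_cast
  rfl

lemma one_sub_norm_sq_le {z : ℂ} (hz : ‖z‖ < 1) : 1 - ‖z‖ ^ 2 ≤ 2 * (1 - ‖z‖) := by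
  nlinarith [norm_nonneg z]

lemma hasDerivAt_one_sub_conj_mul (a z : ℂ) :
    HasDerivAt (fun w => 1 - (starRingEnd ℂ) a * w) (-(starRingEnd ℂ) a) z := by
  simpa using ((hasDerivAt_id z).const_mul ((starRingEnd ℂ) a)).const_sub 1

/-- The function `z ↦ (1 - |a|²) / (1 - ā z)`, which equals `1` at `a`. -/
def peakFunction (a z : ℂ) : ℂ := ((1 - ‖a‖ ^ 2 : ℝ) : ℂ) / (1 - (starRingEnd ℂ) a * z)

lemma peakFunction_self {a : ℂ} (ha : ‖a‖ < 1) : peakFunction a a = 1 := by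
  rw [peakFunction, ← one_sub_conj_mul_self, div_self (one_sub_conj_mul_ne_zero ha ha)]

lemma norm_peakFunction {a : ℂ} (ha : ‖a‖ < 1) (z : ℂ) :
    ‖peakFunction a z‖ = (1 - ‖a‖ ^ 2) / ‖1 - (starRingEnd ℂ) a * z‖ := by
  rw [peakFunction, norm_div, Complex.norm_real, Real.norm_of_nonneg (one_sub_norm_sq_pos ha).le]

lemma norm_peakFunction_le_two {a z : ℂ} (ha : ‖a‖ < 1) (hz : ‖z‖ < 1) :
    ‖peakFunction a z‖ ≤ 2 := by
  have h := one_sub_norm_left_le (a := a) hz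
  rw [norm_peakFunction ha, div_le_iff₀ (by linarith)]
  linarith [one_sub_norm_sq_le ha]

lemma norm_peakFunction_le {a z : ℂ} (ha : ‖a‖ < 1) (hz : ‖z‖ < 1) :
    ‖peakFunction a z‖ ≤ (1 - ‖a‖ ^ 2) / (1 - ‖z‖) := by
  have h := one_sub_norm_right_le (z := z) ha
  have := one_sub_norm_sq_pos ha
  rw [norm_peakFunction ha]
  gcongr

lemma hasDerivAt_peakFunction {a z : ℂ} (ha : ‖a‖ < 1) (hz : ‖z‖ < 1) :
    HasDerivAt (peakFunction a)
      ((starRingEnd ℂ) a * ((1 - ‖a‖ ^ 2 : ℝ) : ℂ) / (1 - (starRingEnd ℂ) a * z) ^ 2) z := by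
  have h := (hasDerivAt_const z (((1 - ‖a‖ ^ 2 : ℝ) : ℂ))).div (hasDerivAt_one_sub_conj_mul a z)
    (one_sub_conj_mul_ne_zero ha hz)
  refine h.congr_deriv ?_
  ring

lemma differentiableOn_peakFunction {a : ℂ} (ha : ‖a‖ < 1) :
    DifferentiableOn ℂ (peakFunction a) unitDisk := fun _ hz =>
  (hasDerivAt_peakFunction ha (mem_unitDisk.1 hz)).differentiableAt.differentiableWithinAt

lemma deriv_peakFunction_self {a : ℂ} (ha : ‖a‖ < 1) :
    deriv (peakFunction a) a = (starRingEnd ℂ) a / ((1 - ‖a‖ ^ 2 : ℝ) : ℂ) := by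
  have h := one_sub_conj_mul_ne_zero ha ha
  rw [(hasDerivAt_peakFunction ha ha).deriv]
  rw [one_sub_conj_mul_self] at h ⊢
  field_simp

lemma weighted_deriv_peakFunction_le {a z : ℂ} (ha : ‖a‖ < 1) (hz : ‖z‖ < 1) :
    (1 - ‖z‖ ^ 2) * ‖deriv (peakFunction a) z‖ ≤ 4 := by
  have h1 := one_sub_norm_left_le (a := a) hz
  have h2 := one_sub_norm_right_le (z := z) ha
  have ha2 := one_sub_norm_sq_pos ha
  have hz2 := one_sub_norm_sq_pos hz
  rw [(hasDerivAt_peakFunction ha hz).deriv, norm_div, norm_mul, RCLike.norm_conj,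
    Complex.norm_real, Real.norm_of_nonneg ha2.le, norm_pow, mul_div_assoc',
    div_le_iff₀ (by have : 0 < ‖1 - (starRingEnd ℂ) a * z‖ := by linarith
                    positivity)]
  set d := ‖1 - (starRingEnd ℂ) a * z‖
  calc (1 - ‖z‖ ^ 2) * (‖a‖ * (1 - ‖a‖ ^ 2)) ≤ (2 * d) * (1 * (2 * d)) := by
        have e1 := (one_sub_norm_sq_le hz).trans (mul_le_mul_of_nonneg_left h2 zero_le_two)
        have e2 := (one_sub_norm_sq_le ha).trans (mul_le_mul_of_nonneg_left h1 zero_le_two)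
        gcongr
    _ = 4 * d ^ 2 := by ring

lemma hasDerivAt_peakComp {h P : ℂ → ℂ} (hP : ∀ w, HasDerivAt h (P w) w) {a z : ℂ}
    (ha : ‖a‖ < 1) (hz : ‖z‖ < 1) :
    HasDerivAt (fun z => (1 / 100 : ℂ) * h (peakFunction a z))
      ((1 / 100 : ℂ) * (P (peakFunction a z) * deriv (peakFunction a) z)) z :=
  (HasDerivAt.comp z (hP _)
    (differentiableAt_of_unitDisk (differentiableOn_peakFunction ha) hz).hasDerivAt).const_mul _

lemma differentiableOn_peakComp {h P : ℂ → ℂ} (hP : ∀ w, HasDerivAt h (P w) w) {a : ℂ}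
    (ha : ‖a‖ < 1) :
    DifferentiableOn ℂ (fun z => (1 / 100 : ℂ) * h (peakFunction a z)) unitDisk := fun _ hz =>
  (hasDerivAt_peakComp hP ha (mem_unitDisk.1 hz)).differentiableAt.differentiableWithinAt

lemma weighted_deriv_peakComp_le {h P : ℂ → ℂ} (hP : ∀ w, HasDerivAt h (P w) w)
    (hPb : ∀ w : ℂ, ‖w‖ ≤ 2 → ‖P w‖ ≤ 21) {a z : ℂ} (ha : ‖a‖ < 1) (hz : ‖z‖ < 1) :
    (1 - ‖z‖ ^ 2) * ‖deriv (fun z => (1 / 100 : ℂ) * h (peakFunction a z)) z‖ ≤ 84 / 100 := by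
  have h1 := hPb _ (norm_peakFunction_le_two ha hz)
  have h2 := weighted_deriv_peakFunction_le ha hz
  have h3 := one_sub_norm_sq_pos hz
  rw [(hasDerivAt_peakComp hP ha hz).deriv, norm_mul, norm_mul]
  rw [show ‖(1 / 100 : ℂ)‖ = 1 / 100 by norm_num]
  calc (1 - ‖z‖ ^ 2) * (1 / 100 * (‖P (peakFunction a z)‖ * ‖deriv (peakFunction a) z‖))
      = 1 / 100 * (‖P (peakFunction a z)‖ * ((1 - ‖z‖ ^ 2) * ‖deriv (peakFunction a) z‖)) := by
        ring
    _ ≤ 1 / 100 * (21 * 4) := by gcongr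
    _ = 84 / 100 := by norm_num

lemma memBloch_peakComp {h P : ℂ → ℂ} (hP : ∀ w, HasDerivAt h (P w) w)
    (hPb : ∀ w : ℂ, ‖w‖ ≤ 2 → ‖P w‖ ≤ 21) {a : ℂ} (ha : ‖a‖ < 1) :
    MemBloch 1 (fun z => (1 / 100 : ℂ) * h (peakFunction a z)) :=
  memBloch_of_forall_norm_deriv_le (differentiableOn_peakComp hP ha)
    fun _ hz => weighted_deriv_peakComp_le hP hPb ha hz

lemma norm_peakComp_le {h : ℂ → ℂ} (hb : ∀ w : ℂ, ‖w‖ ≤ 2 → ‖h w‖ ≤ 9 * ‖w‖) {a z : ℂ}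
    (ha : ‖a‖ < 1) (hz : ‖z‖ < 1) :
    ‖(1 / 100 : ℂ) * h (peakFunction a z)‖ ≤ 9 / 100 * ‖peakFunction a z‖ := by
  rw [norm_mul, show ‖(1 / 100 : ℂ)‖ = 1 / 100 by norm_num]
  linarith [hb _ (norm_peakFunction_le_two ha hz)]

lemma blochNorm_peakComp_le {h P : ℂ → ℂ} (hP : ∀ w, HasDerivAt h (P w) w)
    (hb : ∀ w : ℂ, ‖w‖ ≤ 2 → ‖h w‖ ≤ 9 * ‖w‖)
    (hPb : ∀ w : ℂ, ‖w‖ ≤ 2 → ‖P w‖ ≤ 21) {a : ℂ} (ha : ‖a‖ < 1) :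
    blochNorm 1 (fun z => (1 / 100 : ℂ) * h (peakFunction a z)) ≤ 1 := by
  refine (blochNorm_le_of_forall_norm_deriv_le (C' := 9 / 100) ?_
    fun _ hz => weighted_deriv_peakComp_le hP hPb ha hz).trans (by norm_num)
  have h0 : ‖(0 : ℂ)‖ < 1 := by simp
  have h1 := norm_peakComp_le hb ha h0
  have h2 := norm_peakFunction_le ha h0
  have h3 : (1 - ‖a‖ ^ 2) / (1 - ‖(0 : ℂ)‖) ≤ 1 := by
    simp
  linarith

lemma deriv_deriv_peakComp_self {h P : ℂ → ℂ} (hP : ∀ w, HasDerivAt h (P w) w) {P' : ℂ}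
    (hP1 : P 1 = 0) (hP' : HasDerivAt P P' 1) {a : ℂ} (ha : ‖a‖ < 1) :
    deriv (deriv (fun z => (1 / 100 : ℂ) * h (peakFunction a z))) a =
      (1 / 100 : ℂ) * (P' * ((starRingEnd ℂ) a / ((1 - ‖a‖ ^ 2 : ℝ) : ℂ)) ^ 2) := by
  have hq := differentiableOn_peakFunction ha
  have h1 : deriv (fun z => (1 / 100 : ℂ) * h (peakFunction a z)) =ᶠ[𝓝 a]
      fun z => (1 / 100 : ℂ) * (P (peakFunction a z) * deriv (peakFunction a) z) := by
    filter_upwards [unitDisk_mem_nhds ha] with z hz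
    exact (hasDerivAt_peakComp hP ha (mem_unitDisk.1 hz)).deriv
  have h2 : HasDerivAt (fun z => P (peakFunction a z)) (P' * deriv (peakFunction a) a) a :=
    HasDerivAt.comp a (by rwa [peakFunction_self ha])
      (differentiableAt_of_unitDisk hq ha).hasDerivAt
  have h3 := (h2.mul (differentiableAt_of_unitDisk (hq.deriv isOpen_unitDisk)
    ha).hasDerivAt).const_mul (1 / 100 : ℂ)
  rw [h1.deriv_eq]
  refine h3.deriv.trans ?_
  rw [peakFunction_self ha, hP1, deriv_peakFunction_self ha]
  ring

/-- The logarithmic growth factor `log (e / (1 - x))`. -/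
def logGrowth (x : ℝ) : ℝ := 1 - Real.log (1 - x)

lemma one_le_logGrowth {x : ℝ} (h0 : 0 ≤ x) (h1 : x < 1) : 1 ≤ logGrowth x := by
  have := Real.log_nonpos (x := 1 - x) (by linarith) (by linarith)
  rw [logGrowth]
  linarith

lemma logGrowth_le_inv {x : ℝ} (h1 : x < 1) : logGrowth x ≤ 1 / (1 - x) := by
  have h := Real.log_le_sub_one_of_pos (x := (1 - x)⁻¹) (inv_pos.2 (by linarith))
  rw [Real.log_inv] at h
  rw [logGrowth, one_div]
  linarith

lemma tendsto_inv_logGrowth : Tendsto (fun x => 36 / 100 / logGrowth x) (𝓝[<] 1) (𝓝 0) := by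
  have h1 : Tendsto (fun x : ℝ => 1 - x) (𝓝[<] 1) (𝓝[>] 0) := by
    refine tendsto_nhdsWithin_iff.2 ⟨?_, ?_⟩
    · have : Tendsto (fun x : ℝ => 1 - x) (𝓝 1) (𝓝 (1 - 1)) :=
        (continuous_const.sub continuous_id).tendsto _
      rw [sub_self] at this
      exact this.mono_left nhdsWithin_le_nhds
    · filter_upwards [self_mem_nhdsWithin] with x hx
      simpa using hx
  have h2 : Tendsto logGrowth (𝓝[<] 1) atTop := by
    have := tendsto_neg_atBot_atTop.comp (Real.tendsto_log_nhdsGT_zero.comp h1)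
    have h3 := tendsto_atTop_add_const_left _ (1 : ℝ) this
    refine h3.congr fun x => ?_
    simp [logGrowth, sub_eq_add_neg]
  exact h2.const_div_atTop _

/-- The function `z ↦ log (e / (1 - ā z))`. -/
def logKernel (a z : ℂ) : ℂ := 1 - Complex.log (1 - (starRingEnd ℂ) a * z)

lemma norm_logKernel_le_of_le {a z : ℂ} (ha : ‖a‖ < 1) (hz : ‖z‖ < 1) {x : ℝ} (hx0 : 0 ≤ x)
    (hx1 : x < 1) (hx : 1 - x ≤ ‖1 - (starRingEnd ℂ) a * z‖) :
    ‖logKernel a z‖ ≤ 6 * logGrowth x := by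
  have h2 := norm_one_sub_conj_mul_le ha hz
  set w := 1 - (starRingEnd ℂ) a * z with hw
  have hlow : Real.log (1 - x) ≤ Real.log ‖w‖ := Real.log_le_log (by linarith) hx
  have hup : Real.log ‖w‖ ≤ 1 := by
    have := Real.log_le_sub_one_of_pos (x := ‖w‖) (by linarith)
    linarith
  have hL := one_le_logGrowth hx0 hx1
  have hre : |(Complex.log w).re| ≤ logGrowth x := by
    rw [Complex.log_re, abs_le, logGrowth]
    rw [logGrowth] at hL
    constructor <;> linarith
  have him : |(Complex.log w).im| ≤ 4 := by
    rw [Complex.log_im]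
    exact (Complex.abs_arg_le_pi w).trans Real.pi_le_four
  calc ‖logKernel a z‖ ≤ ‖(1 : ℂ)‖ + ‖Complex.log w‖ := norm_sub_le _ _
    _ ≤ 1 + (|(Complex.log w).re| + |(Complex.log w).im|) := by
        rw [norm_one]
        gcongr
        exact Complex.norm_le_abs_re_add_abs_im _
    _ ≤ 6 * logGrowth x := by linarith

lemma hasDerivAt_logKernel {a z : ℂ} (ha : ‖a‖ < 1) (hz : ‖z‖ < 1) :
    HasDerivAt (logKernel a) ((starRingEnd ℂ) a / (1 - (starRingEnd ℂ) a * z)) z := by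
  have hs : 1 - (starRingEnd ℂ) a * z ∈ Complex.slitPlane := by
    left
    have h1 : ((starRingEnd ℂ) a * z).re ≤ ‖a‖ * ‖z‖ := by
      simpa using Complex.re_le_norm ((starRingEnd ℂ) a * z)
    rw [Complex.sub_re, Complex.one_re]
    nlinarith [norm_nonneg a, norm_nonneg z]
  refine (((hasDerivAt_one_sub_conj_mul a z).clog hs).const_sub 1).congr_deriv ?_
  ring

lemma le_norm_logKernel_self {a : ℂ} (ha : ‖a‖ < 1) :
    3 / 10 * logGrowth ‖a‖ ≤ ‖logKernel a a‖ := by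
  have hpos := one_sub_norm_sq_pos ha
  have h1 : Real.log (1 - ‖a‖ ^ 2) ≤ Real.log 2 + Real.log (1 - ‖a‖) := by
    rw [← Real.log_mul (by norm_num) (by linarith)]
    exact Real.log_le_log hpos (one_sub_norm_sq_le ha)
  have h2 : Real.log (1 - ‖a‖) ≤ 0 := Real.log_nonpos (by linarith) (by linarith [norm_nonneg a])
  have h3 : logKernel a a = ((1 - Real.log (1 - ‖a‖ ^ 2) : ℝ) : ℂ) := by
    rw [logKernel, one_sub_conj_mul_self, ← Complex.ofReal_log hpos.le]
    push_cast
    rfl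
  rw [h3, Complex.norm_real, logGrowth]
  refine le_trans ?_ (le_abs_self _)
  linarith [Real.log_two_lt_d9]

/-- The function `z ↦ log² (e / (1 - ā z)) / (100 log (e / (1 - |a|)))`. -/
def logTest (a z : ℂ) : ℂ := ((1 / (100 * logGrowth ‖a‖) : ℝ) : ℂ) * logKernel a z ^ 2

lemma norm_logTest {a : ℂ} (ha : ‖a‖ < 1) (z : ℂ) :
    ‖logTest a z‖ = ‖logKernel a z‖ ^ 2 / (100 * logGrowth ‖a‖) := by
  have hL := one_le_logGrowth (norm_nonneg a) ha
  rw [logTest, norm_mul, Complex.norm_real, norm_pow, Real.norm_of_nonneg (by positivity)]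
  ring

lemma hasDerivAt_logTest {a z : ℂ} (ha : ‖a‖ < 1) (hz : ‖z‖ < 1) :
    HasDerivAt (logTest a) (((1 / (100 * logGrowth ‖a‖) : ℝ) : ℂ) *
      (2 * logKernel a z * ((starRingEnd ℂ) a / (1 - (starRingEnd ℂ) a * z)))) z := by
  refine (((hasDerivAt_logKernel ha hz).pow 2).const_mul _).congr_deriv ?_
  simp

lemma differentiableOn_logTest {a : ℂ} (ha : ‖a‖ < 1) :
    DifferentiableOn ℂ (logTest a) unitDisk := fun _ hz =>
  (hasDerivAt_logTest ha (mem_unitDisk.1 hz)).differentiableAt.differentiableWithinAt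

lemma weighted_deriv_logTest_le {a z : ℂ} (ha : ‖a‖ < 1) (hz : ‖z‖ < 1) :
    (1 - ‖z‖ ^ 2) * ‖deriv (logTest a) z‖ ≤ 24 / 100 := by
  have hL := one_le_logGrowth (norm_nonneg a) ha
  have h1 := norm_logKernel_le_of_le ha hz (norm_nonneg a) ha (one_sub_norm_left_le hz)
  have h2 := (one_sub_norm_sq_le hz).trans
    (mul_le_mul_of_nonneg_left (one_sub_norm_right_le (z := z) ha) zero_le_two)
  have h3 := one_sub_norm_sq_pos hz
  have h4 : 0 < ‖1 - (starRingEnd ℂ) a * z‖ := norm_pos_iff.2 (one_sub_conj_mul_ne_zero ha hz)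
  rw [(hasDerivAt_logTest ha hz).deriv, norm_mul, norm_mul, norm_mul, norm_div, RCLike.norm_conj,
    Complex.norm_real, Real.norm_of_nonneg (by positivity), Complex.norm_two]
  set d := ‖1 - (starRingEnd ℂ) a * z‖
  set L := logGrowth ‖a‖
  calc (1 - ‖z‖ ^ 2) * (1 / (100 * L) * (2 * ‖logKernel a z‖ * (‖a‖ / d)))
      ≤ (2 * d) * (1 / (100 * L) * (2 * (6 * L) * (1 / d))) := by gcongr
    _ = 24 / 100 := by field_simp; norm_num

lemma memBloch_logTest {a : ℂ} (ha : ‖a‖ < 1) : MemBloch 1 (logTest a) :=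
  memBloch_of_forall_norm_deriv_le (differentiableOn_logTest ha)
    fun _ hz => weighted_deriv_logTest_le ha hz

lemma blochNorm_logTest_le {a : ℂ} (ha : ‖a‖ < 1) : blochNorm 1 (logTest a) ≤ 1 := by
  have hL := one_le_logGrowth (norm_nonneg a) ha
  refine (blochNorm_le_of_forall_norm_deriv_le (C' := 1 / 100) ?_
    fun _ hz => weighted_deriv_logTest_le ha hz).trans (by norm_num)
  rw [norm_logTest ha, div_le_iff₀ (by positivity)]
  simp only [logKernel, mul_zero, sub_zero, Complex.log_one, norm_one]
  linarith

lemma norm_logTest_le {a z : ℂ} (ha : ‖a‖ < 1) (hz : ‖z‖ < 1) :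
    ‖logTest a z‖ ≤ 36 / 100 / logGrowth ‖a‖ / (1 - ‖z‖) ^ 2 := by
  have hL := one_le_logGrowth (norm_nonneg a) ha
  have hd : 0 < 1 - ‖z‖ := by linarith
  have h1 : ‖logKernel a z‖ ≤ 6 * (1 / (1 - ‖z‖)) :=
    (norm_logKernel_le_of_le ha hz (norm_nonneg z) hz (one_sub_norm_right_le ha)).trans
      (by linarith [logGrowth_le_inv hz])
  rw [norm_logTest ha]
  calc ‖logKernel a z‖ ^ 2 / (100 * logGrowth ‖a‖)
      ≤ (6 * (1 / (1 - ‖z‖))) ^ 2 / (100 * logGrowth ‖a‖) := by gcongr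
    _ = _ := by field_simp; norm_num

lemma le_norm_logTest_self {a : ℂ} (ha : ‖a‖ < 1) :
    9 / 10000 * logGrowth ‖a‖ ≤ ‖logTest a a‖ := by
  have hL := one_le_logGrowth (norm_nonneg a) ha
  have h1 := le_norm_logKernel_self ha
  rw [norm_logTest ha, le_div_iff₀ (by positivity)]
  calc 9 / 10000 * logGrowth ‖a‖ * (100 * logGrowth ‖a‖) = (3 / 10 * logGrowth ‖a‖) ^ 2 := by ring
    _ ≤ _ := by gcongr

lemma tendsto_peak_bound :
    Tendsto (fun x : ℝ => 9 / 100 * (1 - x ^ 2)) (𝓝[<] 1) (𝓝 0) := by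
  have h : ContinuousAt (fun x : ℝ => 9 / 100 * (1 - x ^ 2)) 1 := by fun_prop
  have h2 := h.tendsto
  norm_num at h2
  exact h2.mono_left nhdsWithin_le_nhds

lemma exists_forall_weighted_peakComp_le {β : ℝ} {u φ : ℂ → ℂ}
    (hu : DifferentiableOn ℂ u unitDisk) (hφ : DifferentiableOn ℂ φ unitDisk)
    (hmaps : Set.MapsTo φ unitDisk unitDisk)
    (hb : BoundedBlochToZygmund 1 β u φ) {K : (ℂ → ℂ) → ℂ → ℂ}
    (hK : IsCompactOpToZygmund 1 β (MemBloch 1) K) {S : ℝ}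
    (hS : ∀ f, MemBloch 1 f → blochNorm 1 f ≤ 1 →
      zygNorm β (fun z => wcomp u φ f z - K f z) ≤ S)
    {h P : ℂ → ℂ} (hP : ∀ w, HasDerivAt h (P w) w)
    (hh : ∀ w : ℂ, ‖w‖ ≤ 2 → ‖h w‖ ≤ 9 * ‖w‖)
    (hPb : ∀ w : ℂ, ‖w‖ ≤ 2 → ‖P w‖ ≤ 21) (h1 : h 1 = 0)
    {ε : ℝ} (hε : 0 < ε) :
    ∃ s < 1, ∀ z : ℂ, ‖z‖ < 1 → s < ‖φ z‖ →
      (1 - ‖z‖ ^ 2) ^ β *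
        ‖(2 * deriv u z * deriv φ z + u z * deriv (deriv φ) z) *
            ((1 / 100 : ℂ) * (P 1 * ((starRingEnd ℂ) (φ z) / ((1 - ‖φ z‖ ^ 2 : ℝ) : ℂ)))) +
          u z * deriv φ z ^ 2 *
            deriv (deriv (fun w => (1 / 100 : ℂ) * h (peakFunction (φ z) w))) (φ z)‖ ≤
        2 * S + ε := by
  obtain ⟨s, hs, H⟩ := exists_forall_weighted_testFunction_le hu hφ hmaps hb hK hS
    (g := fun a z => (1 / 100 : ℂ) * h (peakFunction a z)) (m := 1)
    (fun a ha => memBloch_peakComp hP hPb ha) (fun a ha => blochNorm_peakComp_le hP hh hPb ha)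
    tendsto_peak_bound (fun a w ha hw => by
      refine (norm_peakComp_le hh ha hw).trans ?_
      rw [pow_one, mul_div_assoc]
      exact mul_le_mul_of_nonneg_left (norm_peakFunction_le ha hw) (by norm_num)) hε
  refine ⟨s, hs, fun z hz hsz => ?_⟩
  have ha : ‖φ z‖ < 1 := mem_unitDisk.1 (hmaps (mem_unitDisk.2 hz))
  have := H z hz hsz
  rw [deriv_deriv_wcomp hu hφ hmaps (memBloch_peakComp hP hPb ha).1 hz,
    (hasDerivAt_peakComp hP ha ha).deriv, peakFunction_self ha, h1, mul_zero, mul_zero, zero_add,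
    deriv_peakFunction_self ha] at this
  exact this

lemma norm_conj_div_ge {a : ℂ} (ha : ‖a‖ < 1) (ha2 : 1 / 2 ≤ ‖a‖) :
    1 / (4 * (1 - ‖a‖)) ≤ ‖(starRingEnd ℂ) a / ((1 - ‖a‖ ^ 2 : ℝ) : ℂ)‖ := by
  have h := one_sub_norm_sq_pos ha
  rw [norm_div, RCLike.norm_conj, Complex.norm_real, Real.norm_of_nonneg h.le,
    div_le_div_iff₀ (by linarith) h]
  nlinarith [one_sub_norm_sq_le ha]

lemma exists_forall_weighted_snd_coeff_le {β : ℝ} {u φ : ℂ → ℂ}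
    (hu : DifferentiableOn ℂ u unitDisk) (hφ : DifferentiableOn ℂ φ unitDisk)
    (hmaps : Set.MapsTo φ unitDisk unitDisk)
    (hb : BoundedBlochToZygmund 1 β u φ) {K : (ℂ → ℂ) → ℂ → ℂ}
    (hK : IsCompactOpToZygmund 1 β (MemBloch 1) K) {S : ℝ}
    (hS : ∀ f, MemBloch 1 f → blochNorm 1 f ≤ 1 →
      zygNorm β (fun z => wcomp u φ f z - K f z) ≤ S) {ε : ℝ} (hε : 0 < ε) :
    ∃ s < 1, 1 / 2 ≤ s ∧ ∀ z : ℂ, ‖z‖ < 1 → s < ‖φ z‖ →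
      (1 - ‖z‖ ^ 2) ^ β * ‖u z * deriv φ z ^ 2‖ ≤ 800 * (2 * S + ε) * (1 - ‖φ z‖) ^ 2 := by
  have hP : ∀ w : ℂ, HasDerivAt (fun w : ℂ => w * (1 - w) ^ 2) ((1 - w) * (1 - 3 * w)) w := by
    intro w
    have h := (hasDerivAt_id w).mul (((hasDerivAt_id w).const_sub 1).pow 2)
    refine h.congr_deriv ?_
    simp
    ring
  have hP' : HasDerivAt (fun w : ℂ => (1 - w) * (1 - 3 * w)) 2 1 := by
    have h := ((hasDerivAt_id (1 : ℂ)).const_sub 1).mul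
      (((hasDerivAt_id (1 : ℂ)).const_mul 3).const_sub 1)
    refine h.congr_deriv ?_
    simp
    norm_num
  have hsub : ∀ w : ℂ, ‖w‖ ≤ 2 → ‖1 - w‖ ≤ 3 := fun w hw => by
    have := norm_sub_le (1 : ℂ) w
    rw [norm_one] at this
    linarith
  have hh : ∀ w : ℂ, ‖w‖ ≤ 2 → ‖w * (1 - w) ^ 2‖ ≤ 9 * ‖w‖ := fun w hw => by
    rw [norm_mul, norm_pow]
    nlinarith [hsub w hw, norm_nonneg w, norm_nonneg (1 - w),
      mul_nonneg (norm_nonneg w) (norm_nonneg (1 - w)), pow_le_pow_left₀ (norm_nonneg (1 - w)) (hsub w hw) 2]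
  have hPb : ∀ w : ℂ, ‖w‖ ≤ 2 → ‖(1 - w) * (1 - 3 * w)‖ ≤ 21 := fun w hw => by
    have h3 : ‖1 - 3 * w‖ ≤ 7 := by
      have := norm_sub_le (1 : ℂ) (3 * w)
      rw [norm_one, norm_mul, show ‖(3 : ℂ)‖ = 3 by norm_num] at this
      linarith
    rw [norm_mul]
    calc _ ≤ (3 : ℝ) * 7 := by gcongr; exact hsub w hw
      _ = 21 := by norm_num
  obtain ⟨s, hs, H⟩ := exists_forall_weighted_peakComp_le hu hφ hmaps hb hK hS hP hh hPb
    (by norm_num) hε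
  refine ⟨max s (1 / 2), max_lt hs (by norm_num), le_max_right _ _, fun z hz hsz => ?_⟩
  have ha : ‖φ z‖ < 1 := mem_unitDisk.1 (hmaps (mem_unitDisk.2 hz))
  have h := H z hz ((le_max_left _ _).trans_lt hsz)
  have hge := norm_conj_div_ge ha ((le_max_right _ _).trans hsz.le)
  have hW := weight_pos β hz
  rw [deriv_deriv_peakComp_self hP (by norm_num) hP' ha, sub_self, zero_mul, zero_mul, mul_zero,
    mul_zero, zero_add, norm_mul (u z * deriv φ z ^ 2), norm_mul (1 / 100 : ℂ),
    norm_mul (2 : ℂ), norm_pow (_ / _),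
    show ‖(1 / 100 : ℂ)‖ = 1 / 100 by norm_num, show ‖(2 : ℂ)‖ = 2 by norm_num] at h
  have hδ : 0 < 1 - ‖φ z‖ := by linarith
  have hsq := pow_le_pow_left₀ (by positivity) hge 2
  have : (1 - ‖z‖ ^ 2) ^ β * (‖u z * deriv φ z ^ 2‖ * (1 / 100 * (2 * (1 / (4 * (1 - ‖φ z‖))) ^ 2)))
      ≤ 2 * S + ε := by
    refine le_trans ?_ h
    gcongr
  have e : (1 - ‖z‖ ^ 2) ^ β * ‖u z * deriv φ z ^ 2‖ =
      800 * ((1 - ‖z‖ ^ 2) ^ β * (‖u z * deriv φ z ^ 2‖ *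
        (1 / 100 * (2 * (1 / (4 * (1 - ‖φ z‖))) ^ 2)))) * (1 - ‖φ z‖) ^ 2 := by
    field_simp
    ring
  rw [e]
  gcongr

lemma exists_forall_weighted_fst_coeff_le {β : ℝ} {u φ : ℂ → ℂ}
    (hu : DifferentiableOn ℂ u unitDisk) (hφ : DifferentiableOn ℂ φ unitDisk)
    (hmaps : Set.MapsTo φ unitDisk unitDisk)
    (hb : BoundedBlochToZygmund 1 β u φ) {K : (ℂ → ℂ) → ℂ → ℂ}
    (hK : IsCompactOpToZygmund 1 β (MemBloch 1) K) {S : ℝ}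
    (hS : ∀ f, MemBloch 1 f → blochNorm 1 f ≤ 1 →
      zygNorm β (fun z => wcomp u φ f z - K f z) ≤ S) {ε : ℝ} (hε : 0 < ε) :
    ∃ s < 1, 1 / 2 ≤ s ∧ ∀ z : ℂ, ‖z‖ < 1 → s < ‖φ z‖ →
      (1 - ‖z‖ ^ 2) ^ β * ‖u z * deriv φ z ^ 2‖ ≤ 800 * (2 * S + ε) * (1 - ‖φ z‖) ^ 2 ∧
      (1 - ‖z‖ ^ 2) ^ β * ‖2 * deriv u z * deriv φ z + u z * deriv (deriv φ) z‖ ≤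
        2000000 * (2 * S + ε) * (1 - ‖φ z‖) := by
  have hP : ∀ w : ℂ, HasDerivAt (fun w : ℂ => w * (1 - w)) (1 - 2 * w) w := by
    intro w
    have h := (hasDerivAt_id w).mul ((hasDerivAt_id w).const_sub 1)
    refine h.congr_deriv ?_
    simp
    ring
  have hsub : ∀ w : ℂ, ‖w‖ ≤ 2 → ‖1 - w‖ ≤ 3 := fun w hw => by
    have := norm_sub_le (1 : ℂ) w
    rw [norm_one] at this
    linarith
  have hh : ∀ w : ℂ, ‖w‖ ≤ 2 → ‖w * (1 - w)‖ ≤ 9 * ‖w‖ := fun w hw => by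
    rw [norm_mul]
    nlinarith [hsub w hw, norm_nonneg w]
  have hPb : ∀ w : ℂ, ‖w‖ ≤ 2 → ‖1 - 2 * w‖ ≤ 21 := fun w hw => by
    have := norm_sub_le (1 : ℂ) (2 * w)
    rw [norm_one, norm_mul, show ‖(2 : ℂ)‖ = 2 by norm_num] at this
    linarith
  obtain ⟨s₁, hs₁, h2s, H₁⟩ := exists_forall_weighted_snd_coeff_le hu hφ hmaps hb hK hS hε
  obtain ⟨s₂, hs₂, H₂⟩ := exists_forall_weighted_peakComp_le hu hφ hmaps hb hK hS hP hh hPb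
    (by norm_num) hε
  refine ⟨max s₁ s₂, max_lt hs₁ hs₂, h2s.trans (le_max_left _ _), fun z hz hsz => ?_⟩
  have hD := H₁ z hz ((le_max_left _ _).trans_lt hsz)
  refine ⟨hD, ?_⟩
  have ha : ‖φ z‖ < 1 := mem_unitDisk.1 (hmaps (mem_unitDisk.2 hz))
  have h := H₂ z hz ((le_max_right _ _).trans_lt hsz)
  have hge := norm_conj_div_ge ha (h2s.trans ((le_max_left _ _).trans hsz.le))
  have hW := weight_pos β hz
  have hδ : 0 < 1 - ‖φ z‖ := by linarith
  have hg2 := ((memBloch_peakComp hP hPb ha).norm_deriv_deriv_le ha).trans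
    (div_le_div_of_nonneg_right (mul_le_mul_of_nonneg_left (blochNorm_peakComp_le hP hh hPb ha)
      zero_le_four) (sq_nonneg _))
  set G := deriv (deriv (fun w => (1 / 100 : ℂ) * (peakFunction (φ z) w *
    (1 - peakFunction (φ z) w)))) (φ z)
  set D := u z * deriv φ z ^ 2
  set B := 2 * deriv u z * deriv φ z + u z * deriv (deriv φ) z
  set q := (starRingEnd ℂ) (φ z) / ((1 - ‖φ z‖ ^ 2 : ℝ) : ℂ)
  set W := (1 - ‖z‖ ^ 2) ^ β
  set δ := 1 - ‖φ z‖
  have hDG : W * ‖D * G‖ ≤ 3200 * (2 * S + ε) := by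
    rw [norm_mul, ← mul_assoc]
    calc W * ‖D‖ * ‖G‖ ≤ (800 * (2 * S + ε) * δ ^ 2) * (4 * 1 / δ ^ 2) :=
          mul_le_mul hD hg2 (norm_nonneg _) ((by positivity : 0 ≤ W * ‖D‖).trans hD)
      _ = 3200 * (2 * S + ε) := by field_simp; ring
  have hBq : W * ‖B * ((1 / 100 : ℂ) * ((1 - 2 * 1) * q))‖ ≤ 3201 * (2 * S + ε) := by
    have : ‖B * ((1 / 100 : ℂ) * ((1 - 2 * 1) * q))‖ ≤
        ‖B * ((1 / 100 : ℂ) * ((1 - 2 * 1) * q)) + D * G‖ + ‖D * G‖ := by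
      simpa using norm_sub_le (B * ((1 / 100 : ℂ) * ((1 - 2 * 1) * q)) + D * G) (D * G)
    nlinarith [mul_le_mul_of_nonneg_left this hW.le]
  rw [norm_mul, norm_mul, norm_mul, show ‖(1 / 100 : ℂ)‖ = 1 / 100 by norm_num,
    show ‖(1 - 2 * 1 : ℂ)‖ = 1 by norm_num] at hBq
  have h5 : W * (‖B‖ * (1 / 100 * (1 * (1 / (4 * δ))))) ≤ 3201 * (2 * S + ε) :=
    le_trans (by gcongr) hBq
  have e : W * ‖B‖ = 400 * (W * (‖B‖ * (1 / 100 * (1 * (1 / (4 * δ)))))) * δ := by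
    field_simp
    ring
  have hX : 0 ≤ 2 * S + ε := by
    have : 0 ≤ W * (‖B‖ * (1 / 100 * (1 * (1 / (4 * δ))))) := by positivity
    linarith
  rw [e]
  calc _ ≤ 400 * (3201 * (2 * S + ε)) * δ := by gcongr
    _ ≤ _ := by nlinarith [mul_nonneg hX hδ.le]

/-- Boundary decay of the three coefficients of the second derivative of `u C_φ f`, forced by
closeness of `u C_φ` to a compact operator. -/
lemma exists_forall_weighted_coeffs_le {β : ℝ} {u φ : ℂ → ℂ}
    (hu : DifferentiableOn ℂ u unitDisk) (hφ : DifferentiableOn ℂ φ unitDisk)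
    (hmaps : Set.MapsTo φ unitDisk unitDisk)
    (hb : BoundedBlochToZygmund 1 β u φ) {K : (ℂ → ℂ) → ℂ → ℂ}
    (hK : IsCompactOpToZygmund 1 β (MemBloch 1) K) {S : ℝ}
    (hS : ∀ f, MemBloch 1 f → blochNorm 1 f ≤ 1 →
      zygNorm β (fun z => wcomp u φ f z - K f z) ≤ S) {ε : ℝ} (hε : 0 < ε) :
    ∃ s < 1, 1 / 2 ≤ s ∧ ∀ z : ℂ, ‖z‖ < 1 → s < ‖φ z‖ →
      (1 - ‖z‖ ^ 2) ^ β * ‖u z * deriv φ z ^ 2‖ ≤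
        10000000000 * (2 * S + ε) * (1 - ‖φ z‖) ^ 2 ∧
      (1 - ‖z‖ ^ 2) ^ β * ‖2 * deriv u z * deriv φ z + u z * deriv (deriv φ) z‖ ≤
        10000000000 * (2 * S + ε) * (1 - ‖φ z‖) ∧
      (1 - ‖z‖ ^ 2) ^ β * ‖deriv (deriv u) z‖ * logGrowth ‖φ z‖ ≤
        10000000000 * (2 * S + ε) := by
  obtain ⟨s₁, hs₁, h2s, H₁⟩ := exists_forall_weighted_fst_coeff_le hu hφ hmaps hb hK hS hε
  obtain ⟨s₂, hs₂, H₂⟩ := exists_forall_weighted_testFunction_le hu hφ hmaps hb hK hS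
    (g := logTest) (m := 2) (fun a ha => memBloch_logTest ha) (fun a ha => blochNorm_logTest_le ha)
    tendsto_inv_logGrowth (fun a w ha hw => norm_logTest_le ha hw) hε
  refine ⟨max s₁ s₂, max_lt hs₁ hs₂, h2s.trans (le_max_left _ _), fun z hz hsz => ?_⟩
  obtain ⟨hD, hB⟩ := H₁ z hz ((le_max_left _ _).trans_lt hsz)
  have h := H₂ z hz ((le_max_right _ _).trans_lt hsz)
  have ha : ‖φ z‖ < 1 := mem_unitDisk.1 (hmaps (mem_unitDisk.2 hz))
  have hW := weight_pos β hz
  have hδ : 0 < 1 - ‖φ z‖ := by linarith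
  have hm := memBloch_logTest ha
  have hn := blochNorm_logTest_le ha
  have hg1 := (hm.norm_deriv_le ha).trans (div_le_div_of_nonneg_right hn hδ.le)
  have hg2 := (hm.norm_deriv_deriv_le ha).trans
    (div_le_div_of_nonneg_right (mul_le_mul_of_nonneg_left hn zero_le_four) (sq_nonneg _))
  have hg0 := le_norm_logTest_self ha
  have hX : 0 ≤ 2 * S + ε := le_trans (by positivity) h
  rw [deriv_deriv_wcomp hu hφ hmaps hm.1 hz] at h
  set g0 := logTest (φ z) (φ z)
  set g1 := deriv (logTest (φ z)) (φ z)
  set g2 := deriv (deriv (logTest (φ z))) (φ z)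
  set D := u z * deriv φ z ^ 2
  set B := 2 * deriv u z * deriv φ z + u z * deriv (deriv φ) z
  set A := deriv (deriv u) z
  set W := (1 - ‖z‖ ^ 2) ^ β
  set δ := 1 - ‖φ z‖
  have hDG : W * ‖D * g2‖ ≤ 3200 * (2 * S + ε) := by
    rw [norm_mul, ← mul_assoc]
    calc W * ‖D‖ * ‖g2‖ ≤ (800 * (2 * S + ε) * δ ^ 2) * (4 * 1 / δ ^ 2) :=
          mul_le_mul hD hg2 (norm_nonneg _) ((by positivity : 0 ≤ W * ‖D‖).trans hD)
      _ = 3200 * (2 * S + ε) := by field_simp; ring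
  have hBG : W * ‖B * g1‖ ≤ 2000000 * (2 * S + ε) := by
    rw [norm_mul, ← mul_assoc]
    calc W * ‖B‖ * ‖g1‖ ≤ (2000000 * (2 * S + ε) * δ) * (1 / δ) :=
          mul_le_mul hB hg1 (norm_nonneg _) ((by positivity : 0 ≤ W * ‖B‖).trans hB)
      _ = 2000000 * (2 * S + ε) := by field_simp
  have hAG : W * ‖A * g0‖ ≤ 2003201 * (2 * S + ε) := by
    have : ‖A * g0‖ ≤ ‖A * g0 + B * g1 + D * g2‖ + ‖B * g1‖ + ‖D * g2‖ := by
      have e : A * g0 = (A * g0 + B * g1 + D * g2) - B * g1 - D * g2 := by ring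
      calc ‖A * g0‖ = ‖(A * g0 + B * g1 + D * g2) - B * g1 - D * g2‖ := by rw [← e]
        _ ≤ _ := (norm_sub_le _ _).trans (by gcongr; exact norm_sub_le _ _)
    nlinarith [mul_le_mul_of_nonneg_left this hW.le]
  rw [norm_mul] at hAG
  have hA : W * (‖A‖ * (9 / 10000 * logGrowth ‖φ z‖)) ≤ 2003201 * (2 * S + ε) :=
    le_trans (by gcongr) hAG
  refine ⟨hD.trans ?_, hB.trans ?_, ?_⟩
  · gcongr; norm_num
  · gcongr; norm_num
  · nlinarith

lemma succ_mul_pow_mul_one_sub_le {x : ℝ} (h0 : 0 ≤ x) (h1 : x ≤ 1) (n : ℕ) :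
    ((n : ℝ) + 1) * x ^ n * (1 - x) ≤ 1 := by
  have key : ((n : ℝ) + 1) * x ^ n * (1 - x) ≤ 1 - x ^ (n + 1) := by
    induction n with
    | zero => simp
    | succ k ih =>
      have h2 : x ^ (k + 1) ≤ 1 := pow_le_one₀ h0 h1
      push_cast
      have h3 := mul_le_mul_of_nonneg_left ih h0
      have h4 := mul_nonneg (sub_nonneg.2 h1) (sub_nonneg.2 h2)
      rw [pow_succ x (k + 1)]
      rw [pow_succ x k] at *
      nlinarith
  linarith [pow_nonneg h0 (n + 1)]

lemma succ_sq_mul_pow_mul_one_sub_sq_le {x : ℝ} (h0 : 0 ≤ x) (h1 : x ≤ 1) (n : ℕ) :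
    ((n : ℝ) + 1) ^ 2 * x ^ n * (1 - x) ^ 2 ≤ 4 := by
  have hy0 := Real.sqrt_nonneg x
  have hy1 : √x ≤ 1 := Real.sqrt_le_one.2 h1
  have hx : x = √x ^ 2 := (Real.sq_sqrt h0).symm
  set y := √x
  have h := succ_mul_pow_mul_one_sub_le hy0 hy1 n
  have hn : 0 ≤ ((n : ℝ) + 1) * y ^ n * (1 - y) :=
    mul_nonneg (by positivity) (sub_nonneg.2 hy1)
  have h2 : (((n : ℝ) + 1) * y ^ n * (1 - y)) ^ 2 ≤ 1 := pow_le_one₀ hn h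
  have h3 : (1 + y) ^ 2 ≤ 4 := by nlinarith
  rw [hx]
  calc ((n : ℝ) + 1) ^ 2 * (y ^ 2) ^ n * (1 - y ^ 2) ^ 2
      = (((n : ℝ) + 1) * y ^ n * (1 - y)) ^ 2 * (1 + y) ^ 2 := by ring
    _ ≤ 1 * 4 := by gcongr
    _ = 4 := by norm_num

lemma log_mul_pow_le_logGrowth {x : ℝ} (h0 : 0 ≤ x) (h1 : x < 1) (n : ℕ) :
    Real.log n * x ^ n ≤ logGrowth x := by
  rcases Nat.eq_zero_or_pos n with rfl | hn
  · simpa using zero_le_one.trans (one_le_logGrowth h0 h1)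
  have hd : 0 < 1 - x := by linarith
  have hn' : (0 : ℝ) < n := by exact_mod_cast hn
  have hp : 0 ≤ x ^ n := pow_nonneg h0 n
  have hp1 : x ^ n ≤ 1 := pow_le_one₀ h0 h1.le
  have e : Real.log n = Real.log (n * (1 - x)) - Real.log (1 - x) := by
    rw [Real.log_mul hn'.ne' hd.ne']
    ring
  have h2 : Real.log (n * (1 - x)) ≤ ((n : ℝ) + 1) * (1 - x) := by
    have := Real.log_le_sub_one_of_pos (mul_pos hn' hd)
    nlinarith
  have h3 : Real.log (1 - x) ≤ 0 := Real.log_nonpos hd.le (by linarith)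
  have h4 := succ_mul_pow_mul_one_sub_le h0 h1.le n
  rw [e, sub_mul, logGrowth]
  have h5 := mul_le_mul_of_nonneg_right h2 hp
  nlinarith

lemma tendsto_succ_mul_pow {s : ℝ} (h0 : 0 ≤ s) (h1 : s < 1) :
    Tendsto (fun n : ℕ => ((n : ℝ) + 1) * s ^ n) atTop (𝓝 0) := by
  have a := tendsto_pow_const_mul_const_pow_of_lt_one 1 h0 h1
  have b := tendsto_pow_atTop_nhds_zero_of_lt_one h0 h1
  have c := a.add b
  rw [add_zero] at c
  exact c.congr fun n => by ring

lemma tendsto_succ_sq_mul_pow {s : ℝ} (h0 : 0 ≤ s) (h1 : s < 1) :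
    Tendsto (fun n : ℕ => ((n : ℝ) + 1) ^ 2 * s ^ n) atTop (𝓝 0) := by
  have a := tendsto_pow_const_mul_const_pow_of_lt_one 2 h0 h1
  have b := tendsto_pow_const_mul_const_pow_of_lt_one 1 h0 h1
  have c := (a.add b).add (b.add (tendsto_pow_atTop_nhds_zero_of_lt_one h0 h1))
  rw [add_zero, add_zero] at c
  exact c.congr fun n => by ring

lemma log_natCast_le (n : ℕ) : Real.log n ≤ (n : ℝ) + 1 := by
  rcases Nat.eq_zero_or_pos n with rfl | hn
  · simp
  · have := Real.log_le_sub_one_of_pos (show (0 : ℝ) < n by exact_mod_cast hn)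
    linarith

lemma tendsto_log_mul_pow {s : ℝ} (h0 : 0 ≤ s) (h1 : s < 1) :
    Tendsto (fun n : ℕ => Real.log n * s ^ n) atTop (𝓝 0) :=
  squeeze_zero (fun n => mul_nonneg (Real.log_natCast_nonneg n) (pow_nonneg h0 n))
    (fun n => mul_le_mul_of_nonneg_right (log_natCast_le n) (pow_nonneg h0 n))
    (tendsto_succ_mul_pow h0 h1)

lemma eventually_mul_wnorm_le {γ : ℝ} {A φ : ℂ → ℂ} {w : ℕ → ℝ} (hw : ∀ n, 0 ≤ w n) {M s Q : ℝ}
    (hM : ∀ z : ℂ, ‖z‖ < 1 → (1 - ‖z‖ ^ 2) ^ γ * ‖A z‖ ≤ M)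
    (hs : Tendsto (fun n => w n * s ^ n) atTop (𝓝 0)) (hQ : 0 ≤ Q)
    (hA : ∀ z : ℂ, ‖z‖ < 1 → s < ‖φ z‖ → ∀ n,
      (1 - ‖z‖ ^ 2) ^ γ * ‖A z‖ * (w n * ‖φ z‖ ^ n) ≤ Q) {ε : ℝ} (hε : 0 < ε) :
    ∀ᶠ n in atTop, w n * wnorm γ (fun z => A z * φ z ^ n) ≤ Q + ε := by
  have hM0 : 0 ≤ M := (mul_nonneg (weight_pos γ (z := 0) (by simp)).le (norm_nonneg _)).trans
    (hM 0 (by simp))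
  have h := hs.const_mul M
  rw [mul_zero] at h
  filter_upwards [h.eventually (gt_mem_nhds hε)] with n hn
  rcases (hw n).eq_or_lt with h0 | h0
  · rw [← h0, zero_mul]
    positivity
  rw [mul_comm, ← le_div_iff₀ h0]
  refine wnorm_le_of_forall fun z hz => ?_
  rw [le_div_iff₀ h0, norm_mul, norm_pow]
  have hW := weight_pos γ (hz)
  by_cases hsz : s < ‖φ z‖
  · calc _ = (1 - ‖z‖ ^ 2) ^ γ * ‖A z‖ * (w n * ‖φ z‖ ^ n) := by ring
      _ ≤ Q := hA z (hz) hsz n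
      _ ≤ Q + ε := by linarith
  · calc _ = (1 - ‖z‖ ^ 2) ^ γ * ‖A z‖ * (w n * ‖φ z‖ ^ n) := by ring
      _ ≤ M * (w n * s ^ n) := by
        gcongr
        · exact hM z (hz)
        · exact not_lt.1 hsz
      _ ≤ Q + ε := by linarith

/-- Closeness of `u C_φ` to a compact operator bounds the three weighted sequences. -/
lemma eventually_sequences_le {β : ℝ} {u φ : ℂ → ℂ}
    (hu : DifferentiableOn ℂ u unitDisk) (hφ : DifferentiableOn ℂ φ unitDisk)
    (hmaps : Set.MapsTo φ unitDisk unitDisk)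
    (hb : BoundedBlochToZygmund 1 β u φ) {K : (ℂ → ℂ) → ℂ → ℂ}
    (hK : IsCompactOpToZygmund 1 β (MemBloch 1) K) {S : ℝ} (hS0 : 0 ≤ S)
    (hS : ∀ f, MemBloch 1 f → blochNorm 1 f ≤ 1 →
      zygNorm β (fun z => wcomp u φ f z - K f z) ≤ S) {ε : ℝ} (hε : 0 < ε) :
    ∀ᶠ n : ℕ in atTop,
      ((n : ℝ) + 1) * wnorm β (fun z => (2 * deriv u z * deriv φ z + u z * deriv (deriv φ) z) *
        φ z ^ n) ≤ 100000000000 * S + ε ∧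
      ((n : ℝ) + 1) ^ 2 * wnorm β (fun z => u z * deriv φ z ^ 2 * φ z ^ n) ≤
        100000000000 * S + ε ∧
      Real.log n * wnorm β (fun z => deriv (deriv u) z * φ z ^ n) ≤ 100000000000 * S + ε := by
  obtain ⟨M, hM0, hM⟩ := exists_forall_weighted_coeff_le hu hφ hmaps hb
  obtain ⟨s, hs, hs2, H⟩ := exists_forall_weighted_coeffs_le hu hφ hmaps hb hK hS
    (ε := ε / 1000000000000) (by positivity)
  have hs0 : 0 ≤ s := by linarith
  have hlt : ∀ z : ℂ, ‖z‖ < 1 → ‖φ z‖ < 1 := fun z hz =>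
    mem_unitDisk.1 (hmaps (mem_unitDisk.2 hz))
  have hQ : 0 ≤ 100000000000 * S + ε / 2 := by positivity
  have hX : 0 ≤ 10000000000 * (2 * S + ε / 1000000000000) := by positivity
  have h1 := eventually_mul_wnorm_le (γ := β) (φ := φ) (w := fun n => (n : ℝ) + 1)
    (fun n => by positivity) (fun z hz => (hM z hz).2.1) (tendsto_succ_mul_pow hs0 hs) hQ
    (fun z hz hsz n => by
      have hδ : 0 ≤ 1 - ‖φ z‖ := by linarith [hlt z hz]
      calc _ ≤ 10000000000 * (2 * S + ε / 1000000000000) * (1 - ‖φ z‖) *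
            (((n : ℝ) + 1) * ‖φ z‖ ^ n) :=
              mul_le_mul_of_nonneg_right (H z hz hsz).2.1 (by positivity)
        _ = 10000000000 * (2 * S + ε / 1000000000000) *
            (((n : ℝ) + 1) * ‖φ z‖ ^ n * (1 - ‖φ z‖)) := by ring
        _ ≤ 10000000000 * (2 * S + ε / 1000000000000) * 1 := by
          gcongr
          exact succ_mul_pow_mul_one_sub_le (norm_nonneg _) (hlt z hz).le n
        _ ≤ 100000000000 * S + ε / 2 := by linarith) (half_pos hε)
  have h2 := eventually_mul_wnorm_le (γ := β) (φ := φ) (w := fun n => ((n : ℝ) + 1) ^ 2)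
    (fun n => by positivity) (fun z hz => (hM z hz).2.2) (tendsto_succ_sq_mul_pow hs0 hs) hQ
    (fun z hz hsz n => by
      calc _ ≤ 10000000000 * (2 * S + ε / 1000000000000) * (1 - ‖φ z‖) ^ 2 *
            (((n : ℝ) + 1) ^ 2 * ‖φ z‖ ^ n) :=
              mul_le_mul_of_nonneg_right (H z hz hsz).1 (by positivity)
        _ = 10000000000 * (2 * S + ε / 1000000000000) *
            (((n : ℝ) + 1) ^ 2 * ‖φ z‖ ^ n * (1 - ‖φ z‖) ^ 2) := by ring
        _ ≤ 10000000000 * (2 * S + ε / 1000000000000) * 4 := by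
          gcongr
          exact succ_sq_mul_pow_mul_one_sub_sq_le (norm_nonneg _) (hlt z hz).le n
        _ ≤ 100000000000 * S + ε / 2 := by linarith) (half_pos hε)
  have h3 := eventually_mul_wnorm_le (γ := β) (φ := φ) (w := fun n => Real.log n)
    (fun n => Real.log_natCast_nonneg n) (fun z hz => (hM z hz).1) (tendsto_log_mul_pow hs0 hs)
    hQ
    (fun z hz hsz n => by
      have hW := weight_pos β hz
      calc _ ≤ (1 - ‖z‖ ^ 2) ^ β * ‖deriv (deriv u) z‖ * logGrowth ‖φ z‖ := by
            gcongr
            exact log_mul_pow_le_logGrowth (norm_nonneg _) (hlt z hz) n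
        _ ≤ 10000000000 * (2 * S + ε / 1000000000000) := (H z hz hsz).2.2
        _ ≤ 100000000000 * S + ε / 2 := by linarith) (half_pos hε)
  filter_upwards [h1, h2, h3] with n a b c
  exact ⟨by linarith, by linarith, by linarith⟩

lemma exists_nat_pow_ge {N : ℕ} {x : ℝ} (h1 : x < 1) (hx : 1 - 1 / 64 < x)
    (hN : 1 - 1 / (2 * ((N : ℝ) + 1)) < x) :
    ∃ n : ℕ, N ≤ n ∧ 1 / 2 ≤ x ^ n ∧ 1 / (2 * (1 - x)) ≤ (n : ℝ) + 1 ∧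
      logGrowth x ≤ 4 * Real.log n := by
  have hδ : 0 < 1 - x := by linarith
  have hδ2 : 1 - x < 1 / 64 := by linarith
  set n := ⌊1 / (2 * (1 - x))⌋₊ with hn
  have hle : (n : ℝ) ≤ 1 / (2 * (1 - x)) := Nat.floor_le (by positivity)
  have hlt : 1 / (2 * (1 - x)) < (n : ℝ) + 1 := Nat.lt_floor_add_one _
  refine ⟨n, ?_, ?_, hlt.le, ?_⟩
  · refine Nat.le_floor ?_
    rw [le_div_iff₀ (by positivity)]
    have h3 : (1 - x) < 1 / (2 * ((N : ℝ) + 1)) := by linarith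
    rw [lt_div_iff₀ (by positivity)] at h3
    nlinarith
  · have h2 := one_add_mul_sub_le_pow (a := x) (by linarith) n
    rw [le_div_iff₀ (by positivity)] at hle
    nlinarith
  · have h4 : 1 / (4 * (1 - x)) ≤ (n : ℝ) := by
      have : 1 / (4 * (1 - x)) + 1 ≤ 1 / (2 * (1 - x)) := by
        rw [div_add_one (by positivity), div_le_div_iff₀ (by positivity) (by positivity)]
        nlinarith
      linarith
    have h5 := Real.log_le_log (by positivity) h4
    rw [one_div, Real.log_inv, Real.log_mul (by norm_num) hδ.ne'] at h5
    have h6 := Real.log_le_log hδ hδ2.le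
    have h7 : Real.log (1 / 64) = -(3 * Real.log 4) := by
      rw [one_div, Real.log_inv, show (64 : ℝ) = 4 ^ 3 by norm_num, Real.log_pow]
      norm_num
    have h8 := Real.one_sub_inv_le_log_of_pos (show (0 : ℝ) < 4 by norm_num)
    rw [h7] at h6
    rw [logGrowth]
    norm_num at h8
    linarith

lemma weighted_mul_pow_le_wnorm {γ M : ℝ} {A φ : ℂ → ℂ}
    (hmaps : Set.MapsTo φ unitDisk unitDisk)
    (hM : ∀ z : ℂ, ‖z‖ < 1 → (1 - ‖z‖ ^ 2) ^ γ * ‖A z‖ ≤ M) (n : ℕ) {z : ℂ} (hz : ‖z‖ < 1) :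
    (1 - ‖z‖ ^ 2) ^ γ * ‖A z‖ * ‖φ z‖ ^ n ≤ wnorm γ (fun z => A z * φ z ^ n) := by
  have hb : BddAbove ((fun z => (1 - ‖z‖ ^ 2) ^ γ * ‖A z * φ z ^ n‖) '' unitDisk) := by
    refine bddAbove_weighted_of_forall (C := M) fun w hw => ?_
    have h1 : ‖φ w‖ < 1 := mem_unitDisk.1 (hmaps (mem_unitDisk.2 hw))
    have h2 := (weight_pos γ hw).le
    rw [norm_mul, norm_pow, ← mul_assoc]
    calc _ ≤ (1 - ‖w‖ ^ 2) ^ γ * ‖A w‖ * 1 := by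
          gcongr
          exact pow_le_one₀ (norm_nonneg _) h1.le
      _ ≤ M := by rw [mul_one]; exact hM w hw
  have := weighted_le_wnorm hb hz
  rwa [norm_mul, norm_pow, ← mul_assoc] at this

/-- Bounds for the three weighted sequences give boundary decay of the coefficients of
the second derivative of `u C_φ f`. -/
lemma exists_forall_weighted_coeffs_le_of_eventually {β M Q : ℝ} {A B D φ : ℂ → ℂ}
    (hmaps : Set.MapsTo φ unitDisk unitDisk)
    (hM : ∀ z : ℂ, ‖z‖ < 1 → (1 - ‖z‖ ^ 2) ^ β * ‖A z‖ ≤ M ∧ (1 - ‖z‖ ^ 2) ^ β * ‖B z‖ ≤ M ∧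
      (1 - ‖z‖ ^ 2) ^ β * ‖D z‖ ≤ M)
    (hB : ∀ᶠ n : ℕ in atTop, ((n : ℝ) + 1) * wnorm β (fun z => B z * φ z ^ n) ≤ Q)
    (hD : ∀ᶠ n : ℕ in atTop, ((n : ℝ) + 1) ^ 2 * wnorm β (fun z => D z * φ z ^ n) ≤ Q)
    (hA : ∀ᶠ n : ℕ in atTop, Real.log n * wnorm β (fun z => A z * φ z ^ n) ≤ Q) :
    ∃ s < 1, 0 ≤ s ∧ ∀ z : ℂ, ‖z‖ < 1 → s < ‖φ z‖ →
      (1 - ‖z‖ ^ 2) ^ β * ‖A z‖ * logGrowth ‖φ z‖ ≤ 8 * Q ∧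
      (1 - ‖z‖ ^ 2) ^ β * ‖B z‖ ≤ 4 * Q * (1 - ‖φ z‖) ∧
      (1 - ‖z‖ ^ 2) ^ β * ‖D z‖ ≤ 8 * Q * (1 - ‖φ z‖) ^ 2 := by
  obtain ⟨N, hN⟩ := eventually_atTop.1 (hB.and (hD.and hA))
  have hNpos : 0 < 1 / (2 * ((N : ℝ) + 1)) := by positivity
  refine ⟨max (1 - 1 / 64) (1 - 1 / (2 * ((N : ℝ) + 1))), max_lt (by norm_num) (by linarith),
    le_trans (by norm_num) (le_max_left _ _), fun z hz hsz => ?_⟩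
  have h1 : ‖φ z‖ < 1 := mem_unitDisk.1 (hmaps (mem_unitDisk.2 hz))
  obtain ⟨n, hn, hx, hn1, hL⟩ := exists_nat_pow_ge h1 ((le_max_left _ _).trans_lt hsz)
    ((le_max_right _ _).trans_lt hsz)
  obtain ⟨eB, eD, eA⟩ := hN n hn
  have pA := weighted_mul_pow_le_wnorm hmaps (fun z hz => (hM z hz).1) n hz
  have pB := weighted_mul_pow_le_wnorm hmaps (fun z hz => (hM z hz).2.1) n hz
  have pD := weighted_mul_pow_le_wnorm hmaps (fun z hz => (hM z hz).2.2) n hz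
  have hW := weight_pos β hz
  have hδ : 0 < 1 - ‖φ z‖ := by linarith
  have hlog : 0 ≤ Real.log n := Real.log_natCast_nonneg n
  have half : ∀ {Y : ℝ}, 0 ≤ Y → Y * (1 / 2) ≤ Y * ‖φ z‖ ^ n := fun hY =>
    mul_le_mul_of_nonneg_left hx hY
  have hA0 : 0 ≤ (1 - ‖z‖ ^ 2) ^ β * ‖A z‖ := by positivity
  have hB0 : 0 ≤ (1 - ‖z‖ ^ 2) ^ β * ‖B z‖ := by positivity
  have hD0 : 0 ≤ (1 - ‖z‖ ^ 2) ^ β * ‖D z‖ := by positivity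
  refine ⟨?_, ?_, ?_⟩
  · have h5 := mul_le_mul_of_nonneg_left ((half hA0).trans pA) hlog
    have h6 := mul_le_mul_of_nonneg_left hL hA0
    nlinarith
  · have h5 : 1 / (2 * (1 - ‖φ z‖)) * ((1 - ‖z‖ ^ 2) ^ β * ‖B z‖ * (1 / 2)) ≤ Q :=
      (mul_le_mul hn1 ((half hB0).trans pB) (by positivity) (by positivity)).trans eB
    calc (1 - ‖z‖ ^ 2) ^ β * ‖B z‖ =
        4 * (1 / (2 * (1 - ‖φ z‖)) * ((1 - ‖z‖ ^ 2) ^ β * ‖B z‖ * (1 / 2))) * (1 - ‖φ z‖) := by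
          field_simp
          ring
      _ ≤ 4 * Q * (1 - ‖φ z‖) := by gcongr
  · have h5 : (1 / (2 * (1 - ‖φ z‖))) ^ 2 * ((1 - ‖z‖ ^ 2) ^ β * ‖D z‖ * (1 / 2)) ≤ Q :=
      (mul_le_mul (pow_le_pow_left₀ (by positivity) hn1 2) ((half hD0).trans pD) (by positivity)
        (by positivity)).trans eD
    calc (1 - ‖z‖ ^ 2) ^ β * ‖D z‖ =
        8 * ((1 / (2 * (1 - ‖φ z‖))) ^ 2 * ((1 - ‖z‖ ^ 2) ^ β * ‖D z‖ * (1 / 2))) *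
          (1 - ‖φ z‖) ^ 2 := by
          field_simp
          ring
      _ ≤ 8 * Q * (1 - ‖φ z‖) ^ 2 := by gcongr

/-- The `k`-th Taylor coefficient of `f` at the origin. -/
def taylorCoeff (f : ℂ → ℂ) (k : ℕ) : ℂ := ((k.factorial : ℂ))⁻¹ * iteratedDeriv k f 0

lemma taylorCoeff_linear_comb {f g : ℂ → ℂ} (hf : DifferentiableOn ℂ f unitDisk)
    (hg : DifferentiableOn ℂ g unitDisk) (a b : ℂ) (k : ℕ) :
    taylorCoeff (fun z => a * f z + b * g z) k = a * taylorCoeff f k + b * taylorCoeff g k := by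
  have key : ∀ {h : ℂ → ℂ} (_ : DifferentiableOn ℂ h unitDisk) (c : ℂ),
      ContDiffAt ℂ k (fun z => c * h z) 0 := fun hh c =>
    (((hh.const_mul c).analyticAt (unitDisk_mem_nhds (by simp))).contDiffAt)
  simp only [taylorCoeff]
  rw [iteratedDeriv_fun_add (key hf a) (key hg b), iteratedDeriv_const_mul_field,
    iteratedDeriv_const_mul_field]
  ring

lemma norm_taylorCoeff_le {f : ℂ → ℂ} (hf : MemBloch 1 f) {t : ℝ} (ht0 : 0 < t) (ht1 : t < 1)
    (k : ℕ) : ‖taylorCoeff f k‖ ≤ blochNorm 1 f * (1 - Real.log (1 - t)) / t ^ k := by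
  have hd : DiffContOnCl ℂ f (Metric.ball 0 t) := by
    refine DifferentiableOn.diffContOnCl (hf.1.mono ?_)
    rw [closure_ball _ ht0.ne']
    exact fun z hz => mem_unitDisk.2 ((mem_closedBall_zero_iff.1 hz).trans_lt ht1)
  have h := Complex.norm_iteratedDeriv_le_of_forall_mem_sphere_norm_le k ht0 hd (fun z hz => by
    rw [mem_sphere_zero_iff_norm] at hz
    have := hf.norm_le (z := z) (by linarith)
    rwa [hz] at this)
  rw [taylorCoeff, norm_mul, norm_inv, Complex.norm_natCast, inv_mul_le_iff₀
    (by exact_mod_cast k.factorial_pos)]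
  exact h.trans (le_of_eq (by ring))

lemma norm_taylor_tail_le {f : ℂ → ℂ} (hf : MemBloch 1 f) (hf1 : blochNorm 1 f ≤ 1) {t : ℝ}
    (ht0 : 0 < t) (ht1 : t < 1) (N : ℕ) {w : ℂ} (hw : ‖w‖ ≤ 1 / t) :
    ‖f ((t ^ 3 : ℝ) * w) -
        ∑ k ∈ Finset.range N, taylorCoeff f k * ((t ^ 3 : ℝ) : ℂ) ^ k * w ^ k‖ ≤
      (1 - Real.log (1 - t)) * t ^ N / (1 - t) := by
  have hlog : 0 ≤ 1 - Real.log (1 - t) := by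
    linarith [Real.log_nonpos (by linarith : 0 ≤ 1 - t) (by linarith)]
  have ht3 : ‖((t ^ 3 : ℝ) : ℂ)‖ = t ^ 3 := by
    rw [Complex.norm_real, Real.norm_of_nonneg (by positivity)]
  have hlt : ‖((t ^ 3 : ℝ) : ℂ) * w‖ < 1 := by
    rw [norm_mul, ht3]
    calc t ^ 3 * ‖w‖ ≤ t ^ 3 * (1 / t) := by gcongr
      _ = t ^ 2 := by field_simp
      _ < 1 := by nlinarith
  have hs := Complex.hasSum_taylorSeries_on_ball hf.1 (mem_unitDisk.2 hlt)
  have e : (fun n : ℕ => ((n.factorial : ℂ))⁻¹ • (((t ^ 3 : ℝ) : ℂ) * w - 0) ^ n •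
      iteratedDeriv n f 0) = fun n => taylorCoeff f n * ((t ^ 3 : ℝ) : ℂ) ^ n * w ^ n := by
    funext n
    simp only [smul_eq_mul, sub_zero, taylorCoeff, mul_pow]
    ring
  rw [e] at hs
  rw [norm_sub_rev]
  refine norm_sub_le_of_geometric_bound_of_hasSum ht1 (fun n => ?_) hs N
  rw [norm_mul, norm_mul, norm_pow, norm_pow, ht3]
  calc ‖taylorCoeff f n‖ * (t ^ 3) ^ n * ‖w‖ ^ n
      ≤ (1 * (1 - Real.log (1 - t)) / t ^ n) * (t ^ 3) ^ n * (1 / t) ^ n := by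
        gcongr
        exact (norm_taylorCoeff_le hf ht0 ht1 n).trans (by gcongr)
    _ = (1 - Real.log (1 - t)) * t ^ n := by
        have : t ^ n ≠ 0 := by positivity
        rw [div_pow, one_pow, ← pow_mul, mul_comm 3 n, pow_mul]
        field_simp

lemma norm_deriv_dilation_le {f : ℂ → ℂ} (hf : MemBloch 1 f) {r : ℝ} (h0 : 0 ≤ r) (h1 : r ≤ 1) :
    MemBloch 1 (fun w => f ((r : ℂ) * w)) ∧
      blochNorm 1 (fun w => f ((r : ℂ) * w)) ≤ blochNorm 1 f := by
  have hr : ‖(r : ℂ)‖ = r := by rw [Complex.norm_real, Real.norm_of_nonneg h0]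
  have hle : ∀ z : ℂ, ‖(r : ℂ) * z‖ ≤ ‖z‖ := fun z => by
    rw [norm_mul, hr]
    exact mul_le_of_le_one_left (norm_nonneg z) h1
  have hd : ∀ z : ℂ, ‖z‖ < 1 →
      HasDerivAt (fun w => f ((r : ℂ) * w)) (deriv f ((r : ℂ) * z) * r) z := fun z hz =>
    HasDerivAt.comp z (differentiableAt_of_unitDisk hf.1 ((hle z).trans_lt hz)).hasDerivAt
      (by simpa using (hasDerivAt_id z).const_mul (r : ℂ))
  have hb : ∀ z : ℂ, ‖z‖ < 1 → (1 - ‖z‖ ^ 2) * ‖deriv (fun w => f ((r : ℂ) * w)) z‖ ≤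
      wnorm 1 (deriv f) := fun z hz => by
    have h := weighted_le_wnorm hf.2 ((hle z).trans_lt hz)
    rw [Real.rpow_one] at h
    refine le_trans ?_ h
    rw [(hd z hz).deriv, norm_mul, hr]
    have h2 := one_sub_norm_sq_pos hz
    have h3 := pow_le_pow_left₀ (norm_nonneg _) (hle z) 2
    refine mul_le_mul (by linarith) (mul_le_of_le_one_right (norm_nonneg _) h1) (by positivity)
      (by linarith)
  refine ⟨memBloch_of_forall_norm_deriv_le (fun z hz =>
    (hd z (mem_unitDisk.1 hz)).differentiableAt.differentiableWithinAt) hb, ?_⟩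
  exact blochNorm_le_of_forall_norm_deriv_le (by simp) hb

lemma norm_sub_dilation_le {f : ℂ → ℂ} (hf : MemBloch 1 f) (hf1 : blochNorm 1 f ≤ 1) {r σ : ℝ}
    (h0 : 0 ≤ r) (h1 : r ≤ 1) (hσ : σ < 1) {w : ℂ} (hw : ‖w‖ ≤ σ) :
    ‖f w - f ((r : ℂ) * w)‖ ≤ (1 - r) / (1 - σ) := by
  have hσ0 : 0 ≤ σ := (norm_nonneg w).trans hw
  have hr : ‖(r : ℂ)‖ = r := by rw [Complex.norm_real, Real.norm_of_nonneg h0]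
  have hlt : ∀ z ∈ Metric.closedBall (0 : ℂ) σ, ‖z‖ < 1 := fun z hz =>
    (mem_closedBall_zero_iff.1 hz).trans_lt hσ
  have h := Convex.norm_image_sub_le_of_norm_deriv_le (f := f) (s := Metric.closedBall (0 : ℂ) σ)
    (x := (r : ℂ) * w) (y := w) (C := 1 / (1 - σ))
    (fun z hz => differentiableAt_of_unitDisk hf.1 (hlt z hz))
    (fun z hz => (hf.norm_deriv_le (hlt z hz)).trans (by
      have h2 : ‖z‖ ≤ σ := mem_closedBall_zero_iff.1 hz
      have h3 : 0 < 1 - σ := by linarith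
      exact div_le_div₀ zero_le_one hf1 h3 (by linarith))) (convex_closedBall _ _)
    (by rw [mem_closedBall_zero_iff, norm_mul, hr]
        exact (mul_le_of_le_one_left (norm_nonneg w) h1).trans hw)
    (mem_closedBall_zero_iff.2 hw)
  refine h.trans ?_
  have e : w - (r : ℂ) * w = ((1 - r : ℝ) : ℂ) * w := by push_cast; ring
  rw [e, norm_mul, Complex.norm_real, Real.norm_of_nonneg (by linarith), div_mul_eq_mul_div, one_mul]
  have h3 : 0 < 1 - σ := by linarith
  gcongr
  exact mul_le_of_le_one_right (by linarith) (by linarith)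

lemma norm_derivs_le_of_forall_norm_le {G : ℂ → ℂ} (hG : DifferentiableOn ℂ G unitDisk) {s η : ℝ}
    (hs0 : 0 ≤ s) (hs : s < 1) (hη : 0 ≤ η)
    (h : ∀ w : ℂ, ‖w‖ ≤ (1 + s) / 2 → ‖G w‖ ≤ η * ((1 - s) / 4) ^ 2) {w : ℂ} (hw : ‖w‖ ≤ s) :
    ‖G w‖ ≤ η ∧ ‖deriv G w‖ ≤ η ∧ ‖deriv (deriv G) w‖ ≤ η := by
  set ρ := (1 - s) / 4 with hρ
  have hρ0 : 0 < ρ := by rw [hρ]; linarith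
  have hρ1 : ρ ≤ 1 := by rw [hρ]; linarith
  have h1 : ∀ w : ℂ, ‖w‖ ≤ s + ρ → ‖deriv G w‖ ≤ η * ρ := fun w hw => by
    refine (norm_deriv_le_of_forall_norm_le (R := 1) hG hρ0 (by linarith) (fun v hv =>
      h v (by linarith))).trans (le_of_eq ?_)
    field_simp
  have h2 : ‖deriv (deriv G) w‖ ≤ η := by
    refine (norm_deriv_le_of_forall_norm_le (R := 1) (hG.deriv isOpen_unitDisk) hρ0
      (by linarith) (fun v hv => h1 v (by linarith))).trans (le_of_eq ?_)
    field_simp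
  exact ⟨(h w (by linarith)).trans (mul_le_of_le_one_right hη (pow_le_one₀ hρ0.le hρ1)),
    (h1 w (by linarith)).trans (mul_le_of_le_one_right hη hρ1), h2⟩

/-- Functions in the unit ball of the Bloch space are approximated, uniformly on compact sets
together with two derivatives, by dilated Taylor polynomials of a fixed degree, with uniformly
controlled Bloch norm. -/
lemma exists_dilated_taylor_approx {s η : ℝ} (hs0 : 0 ≤ s) (hs : s < 1) (hη : 0 < η) :
    ∃ (r : ℝ) (N : ℕ), ∀ f, MemBloch 1 f → blochNorm 1 f ≤ 1 →
      MemBloch 1 (fun w => f w - ∑ k ∈ Finset.range N, taylorCoeff f k * (r : ℂ) ^ k * w ^ k) ∧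
      blochNorm 1 (fun w => f w - ∑ k ∈ Finset.range N, taylorCoeff f k * (r : ℂ) ^ k * w ^ k) ≤
        3 ∧
      ∀ w : ℂ, ‖w‖ ≤ s →
        ‖f w - ∑ k ∈ Finset.range N, taylorCoeff f k * (r : ℂ) ^ k * w ^ k‖ ≤ η ∧
        ‖deriv (fun w => f w - ∑ k ∈ Finset.range N, taylorCoeff f k * (r : ℂ) ^ k * w ^ k) w‖ ≤
          η ∧
        ‖deriv (deriv (fun w => f w -
          ∑ k ∈ Finset.range N, taylorCoeff f k * (r : ℂ) ^ k * w ^ k)) w‖ ≤ η := by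
  set η₀ := η * ((1 - s) / 4) ^ 2 with hη₀
  have hη₀pos : 0 < η₀ := by
    have : 0 < 1 - s := by linarith
    positivity
  set t := 1 - min (1 / 2) (η₀ * (1 - s) / 12) with ht
  have hmin : 0 < min (1 / 2) (η₀ * (1 - s) / 12) :=
    lt_min (by norm_num) (by have : 0 < 1 - s := by linarith
                             positivity)
  have ht1 : t < 1 := by linarith
  have ht0 : 0 < t := by linarith [min_le_left (1 / 2) (η₀ * (1 - s) / 12)]
  have ht2 : 1 - t ≤ η₀ * (1 - s) / 12 := by
    linarith [min_le_right (1 / 2) (η₀ * (1 - s) / 12)]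
  have hr1 : t ^ 3 ≤ 1 := pow_le_one₀ ht0.le ht1.le
  have hr0 : 0 ≤ t ^ 3 := by positivity
  have hRt : 1 < 1 / t := by rw [lt_div_iff₀ ht0]; linarith
  set ρ := (1 / t - 1) / 2 with hρ
  have hρ0 : 0 < ρ := by rw [hρ]; linarith
  have htend : Tendsto (fun N : ℕ => (1 - Real.log (1 - t)) * t ^ N / (1 - t)) atTop (𝓝 0) := by
    have h := ((tendsto_pow_atTop_nhds_zero_of_lt_one ht0.le ht1).const_mul
      (1 - Real.log (1 - t))).div_const (1 - t)
    simpa using h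
  obtain ⟨N, hN1, hN2⟩ := ((htend.eventually (gt_mem_nhds (half_pos hη₀pos))).and
    (htend.eventually (gt_mem_nhds (show 0 < min (1 / 2) (ρ / 2) by positivity)))).exists
  refine ⟨t ^ 3, N, fun f hf hf1 => ?_⟩
  set P : ℂ → ℂ := fun w => ∑ k ∈ Finset.range N, taylorCoeff f k * ((t ^ 3 : ℝ) : ℂ) ^ k * w ^ k
    with hP
  obtain ⟨hm, hn⟩ := norm_deriv_dilation_le hf hr0 hr1
  have htail : ∀ w : ℂ, ‖w‖ ≤ 1 / t → ‖f ((t ^ 3 : ℝ) * w) - P w‖ ≤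
      (1 - Real.log (1 - t)) * t ^ N / (1 - t) := fun w hw =>
    norm_taylor_tail_le hf hf1 ht0 ht1 N hw
  have hPd : Differentiable ℂ P := by
    rw [hP]
    fun_prop
  have hdiff : DifferentiableOn ℂ (fun w => f ((t ^ 3 : ℝ) * w) - P w)
      (Metric.ball 0 (1 / t)) := by
    refine DifferentiableOn.sub ?_ hPd.differentiableOn
    refine hf.1.comp (by fun_prop) fun w hw => ?_
    rw [mem_ball_zero_iff, lt_div_iff₀ ht0] at hw
    rw [mem_unitDisk, norm_mul, Complex.norm_real, Real.norm_of_nonneg hr0]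
    nlinarith [norm_nonneg w, pow_le_one₀ ht0.le ht1.le (n := 2),
      mul_nonneg (norm_nonneg w) ht0.le, pow_pos ht0 2]
  have hsubset : unitDisk ⊆ Metric.ball (0 : ℂ) (1 / t) := Metric.ball_subset_ball hRt.le
  have hder : ∀ z : ℂ, ‖z‖ < 1 →
      (1 - ‖z‖ ^ 2) * ‖deriv (fun w => f ((t ^ 3 : ℝ) * w) - P w) z‖ ≤ 1 / 2 := fun z hz => by
    have h1 := norm_deriv_le_of_forall_norm_le hdiff hρ0 (z := z) (by rw [hρ]; linarith)
      (fun w hw => htail w (by rw [hρ] at hw; linarith))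
    have h2 : (1 - Real.log (1 - t)) * t ^ N / (1 - t) / ρ ≤ 1 / 2 := by
      rw [div_le_iff₀ hρ0]
      linarith [hN2.le.trans (min_le_right _ _)]
    have h3 := one_sub_norm_sq_pos hz
    nlinarith [norm_nonneg (deriv (fun w => f ((t ^ 3 : ℝ) * w) - P w) z), sq_nonneg ‖z‖]
  have hm2 := memBloch_of_forall_norm_deriv_le (hdiff.mono hsubset) hder
  have hn2 := blochNorm_le_of_forall_norm_deriv_le (C' := 1 / 2)
    ((htail 0 (by simp [ht0.le])).trans (hN2.le.trans (min_le_left _ _))) hder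
  have e : (fun w => f w - P w) =
      fun w => 1 * (f w - f ((t ^ 3 : ℝ) * w)) + 1 * (f ((t ^ 3 : ℝ) * w) - P w) := by
    funext w
    ring
  have hM : MemBloch 1 (fun w => f w - P w) := by
    rw [e]
    exact (hf.sub hm).linear_comb hm2 1 1
  refine ⟨hM, ?_, fun w hw => ?_⟩
  · have h1 := blochNorm_linear_comb_le (hf.sub hm) hm2 1 1
    have h2 := blochNorm_sub_le hf hm
    rw [norm_one, one_mul, one_mul, ← e] at h1
    change blochNorm 1 (fun w => f w - P w) ≤ 3
    linarith
  · refine norm_derivs_le_of_forall_norm_le hM.1 hs0 hs hη.le (fun w hw => ?_) hw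
    have h1 := norm_sub_dilation_le hf hf1 hr0 hr1 (by linarith : (1 + s) / 2 < 1) hw
    have h2 := htail w (by linarith)
    have h3 : (1 - t ^ 3) / (1 - (1 + s) / 2) ≤ η₀ / 2 := by
      rw [div_le_iff₀ (by linarith)]
      nlinarith [mul_nonneg ht0.le (sub_nonneg.2 ht1.le)]
    calc ‖f w - P w‖ = ‖(f w - f ((t ^ 3 : ℝ) * w)) + (f ((t ^ 3 : ℝ) * w) - P w)‖ := by
          congr 1
          ring
      _ ≤ _ := norm_add_le _ _
      _ ≤ η₀ := by linarith

lemma isCompactOpToZygmund_finiteRank {β : ℝ} {e : ℕ → ℂ → ℂ} (he : ∀ k, MemZygmund β (e k))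
    {c : (ℂ → ℂ) → ℕ → ℂ}
    (hlin : ∀ f g, MemBloch 1 f → MemBloch 1 g → ∀ (a b : ℂ) (k : ℕ),
      c (fun z => a * f z + b * g z) k = a * c f k + b * c g k)
    {A : ℕ → ℝ} (hA0 : ∀ k, 0 ≤ A k)
    (hA : ∀ f, MemBloch 1 f → ∀ k, ‖c f k‖ ≤ A k * blochNorm 1 f) (N : ℕ) :
    IsCompactOpToZygmund 1 β (MemBloch 1)
      (fun f z => ∑ k ∈ Finset.range N, c f k * e k z) := by
  refine ⟨fun f g hf hg a b => ?_, fun f _ => MemZygmund.sum he _ N,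
    ⟨∑ k ∈ Finset.range N, A k * zygNorm β (e k), fun f hf => ?_⟩, fun ε hε => ?_⟩
  · funext z
    simp only [hlin f g hf hg, Finset.mul_sum, ← Finset.sum_add_distrib]
    exact Finset.sum_congr rfl fun k _ => by ring
  · refine (zygNorm_sum_le he _ N).trans ?_
    rw [Finset.sum_mul]
    refine Finset.sum_le_sum fun k _ => ?_
    calc ‖c f k‖ * zygNorm β (e k) ≤ (A k * blochNorm 1 f) * zygNorm β (e k) :=
          mul_le_mul_of_nonneg_right (hA f hf k) (zygNorm_nonneg β _)
      _ = A k * zygNorm β (e k) * blochNorm 1 f := by ring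
  · classical
    have hZ : 0 ≤ ∑ k ∈ Finset.range N, zygNorm β (e k) :=
      Finset.sum_nonneg fun k _ => zygNorm_nonneg β _
    set Z := ∑ k ∈ Finset.range N, zygNorm β (e k)
    have hR : 0 ≤ ∑ k ∈ Finset.range N, A k := Finset.sum_nonneg fun k _ => hA0 k
    obtain ⟨t, htfin, ht⟩ := Metric.totallyBounded_iff.1
      (isCompact_closedBall (0 : Fin N → ℂ) (∑ k ∈ Finset.range N, A k)).totallyBounded
      (ε / (1 + Z)) (by positivity)
    let ext : (Fin N → ℂ) → ℕ → ℂ := fun y k => if h : k < N then y ⟨k, h⟩ else 0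
    refine ⟨htfin.toFinset.image fun y z => ∑ k ∈ Finset.range N, ext y k * e k z, ?_, ?_⟩
    · intro g hg
      obtain ⟨y, -, rfl⟩ := Finset.mem_image.1 hg
      exact MemZygmund.sum he _ N
    · intro f hf hf1
      have hmem : (fun k : Fin N => c f k) ∈
          Metric.closedBall (0 : Fin N → ℂ) (∑ k ∈ Finset.range N, A k) := by
        rw [mem_closedBall_zero_iff, pi_norm_le_iff_of_nonneg hR]
        intro k
        calc ‖c f k‖ ≤ A k * blochNorm 1 f := hA f hf k
          _ ≤ A k * 1 := mul_le_mul_of_nonneg_left hf1 (hA0 k)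
          _ = A k := mul_one _
          _ ≤ ∑ k ∈ Finset.range N, A k :=
            Finset.single_le_sum (fun i _ => hA0 i) (Finset.mem_range.2 k.2)
      obtain ⟨y, hy, hdist⟩ := Set.mem_iUnion₂.1 (ht hmem)
      refine ⟨_, Finset.mem_image_of_mem _ (htfin.mem_toFinset.2 hy), ?_⟩
      have hsum : (fun z => ∑ k ∈ Finset.range N, c f k * e k z -
          ∑ k ∈ Finset.range N, ext y k * e k z) =
          fun z => ∑ k ∈ Finset.range N, (c f k - ext y k) * e k z := by
        funext z
        rw [← Finset.sum_sub_distrib]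
        exact Finset.sum_congr rfl fun k _ => by ring
      rw [hsum]
      refine (zygNorm_sum_le he _ N).trans ?_
      have hk : ∀ k ∈ Finset.range N, ‖c f k - ext y k‖ * zygNorm β (e k) ≤
          ε / (1 + Z) * zygNorm β (e k) := fun k hk => by
        have hkN := Finset.mem_range.1 hk
        refine mul_le_mul_of_nonneg_right ?_ (zygNorm_nonneg β _)
        have h1 := (dist_le_pi_dist (fun k : Fin N => c f k) y ⟨k, hkN⟩).trans
          (Metric.mem_ball.1 hdist).le
        rw [dist_eq_norm] at h1
        simpa only [ext, hkN, dite_true] using h1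
      refine (Finset.sum_le_sum hk).trans ?_
      rw [← Finset.mul_sum, div_mul_eq_mul_div, div_le_iff₀ (by positivity)]
      exact mul_le_mul_of_nonneg_left (by linarith) hε.le

lemma isCompactOpToZygmund_taylor {β : ℝ} {u φ : ℂ → ℂ} (hb : BoundedBlochToZygmund 1 β u φ)
    (r : ℝ) (N : ℕ) :
    IsCompactOpToZygmund 1 β (MemBloch 1) (fun f z => ∑ k ∈ Finset.range N,
      taylorCoeff f k * (r : ℂ) ^ k * wcomp u φ (fun w => w ^ k) z) := by
  have hlog : 0 ≤ 1 - Real.log (1 - 1 / 2) := by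
    linarith [Real.log_nonpos (show (0 : ℝ) ≤ 1 - 1 / 2 by norm_num) (by norm_num)]
  refine isCompactOpToZygmund_finiteRank (c := fun f k => taylorCoeff f k * (r : ℂ) ^ k)
    (A := fun k => (1 - Real.log (1 - 1 / 2)) / (1 / 2) ^ k * ‖(r : ℂ) ^ k‖)
    (fun k => hb.1 _ (memBloch_pow k)) (fun f g hf hg a b k => ?_) (fun k => by positivity)
    (fun f hf k => ?_) N
  · simp only [taylorCoeff_linear_comb hf.1 hg.1]
    ring
  · rw [norm_mul]
    calc _ ≤ blochNorm 1 f * (1 - Real.log (1 - 1 / 2)) / (1 / 2) ^ k * ‖(r : ℂ) ^ k‖ :=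
          mul_le_mul_of_nonneg_right (norm_taylorCoeff_le hf (by norm_num) (by norm_num) k)
            (norm_nonneg _)
      _ = _ := by ring

lemma wcomp_sub_taylor (u φ f : ℂ → ℂ) (r : ℝ) (N : ℕ) :
    (fun z => wcomp u φ f z - ∑ k ∈ Finset.range N,
      taylorCoeff f k * (r : ℂ) ^ k * wcomp u φ (fun w => w ^ k) z) =
    wcomp u φ (fun w => f w - ∑ k ∈ Finset.range N, taylorCoeff f k * (r : ℂ) ^ k * w ^ k) := by
  funext z
  simp only [wcomp, mul_sub, Finset.mul_sum]
  congr 1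
  exact Finset.sum_congr rfl fun k _ => by ring

lemma isCompactOpToZygmund_zero (β : ℝ) :
    IsCompactOpToZygmund 1 β (MemBloch 1) (fun _ _ => 0) := by
  have h := isCompactOpToZygmund_finiteRank (β := β) (e := fun _ _ => 0)
    (fun _ => memZygmund_zero β) (c := fun _ _ => 0) (fun _ _ _ _ _ _ _ => by simp)
    (A := fun _ => 0) (fun _ => le_rfl) (fun _ _ _ => by simp) 0
  simpa using h

lemma memBloch_zero (α : ℝ) : MemBloch α (fun _ => 0) :=
  ⟨differentiableOn_const 0, bddAbove_weighted_of_forall (C := 0) fun z _ => by simp⟩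

lemma blochNorm_zero (α : ℝ) : blochNorm α (fun _ => 0) ≤ 0 := by
  have : wnorm α (deriv (fun _ : ℂ => (0 : ℂ))) ≤ 0 := wnorm_le_of_forall fun z _ => by simp
  simpa [blochNorm] using this

lemma opNorm_nonneg (α β : ℝ) (P : (ℂ → ℂ) → Prop) (u φ : ℂ → ℂ) (K : (ℂ → ℂ) → ℂ → ℂ) :
    0 ≤ sSup {s | ∃ f, P f ∧ blochNorm α f ≤ 1 ∧
      s = zygNorm β (fun z => wcomp u φ f z - K f z)} :=
  Real.sSup_nonneg (by rintro _ ⟨f, -, -, rfl⟩; exact zygNorm_nonneg β _)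

lemma essNormZ_le_of_forall {β S : ℝ} {u φ : ℂ → ℂ} {K : (ℂ → ℂ) → ℂ → ℂ}
    (hK : IsCompactOpToZygmund 1 β (MemBloch 1) K)
    (hS : ∀ f, MemBloch 1 f → blochNorm 1 f ≤ 1 →
      zygNorm β (fun z => wcomp u φ f z - K f z) ≤ S) :
    essNormZ 1 β (MemBloch 1) u φ ≤ S := by
  have hle : essNormZ 1 β (MemBloch 1) u φ ≤ sSup {s | ∃ f, MemBloch 1 f ∧ blochNorm 1 f ≤ 1 ∧
      s = zygNorm β (fun z => wcomp u φ f z - K f z)} := by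
    refine csInf_le ⟨0, ?_⟩ ⟨K, hK, rfl⟩
    rintro _ ⟨K', -, rfl⟩
    exact opNorm_nonneg 1 β _ u φ K'
  refine hle.trans (csSup_le ?_ ?_)
  · exact ⟨_, fun _ => 0, memBloch_zero 1, (blochNorm_zero 1).trans zero_le_one, rfl⟩
  · rintro _ ⟨f, hf, hf1, rfl⟩
    exact hS f hf hf1

lemma le_essNormZ {β X : ℝ} {u φ : ℂ → ℂ} (hb : BoundedBlochToZygmund 1 β u φ)
    (h : ∀ K, IsCompactOpToZygmund 1 β (MemBloch 1) K → ∀ S, 0 ≤ S →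
      (∀ f, MemBloch 1 f → blochNorm 1 f ≤ 1 →
        zygNorm β (fun z => wcomp u φ f z - K f z) ≤ S) → X ≤ S) :
    X ≤ essNormZ 1 β (MemBloch 1) u φ := by
  refine le_csInf ⟨_, _, isCompactOpToZygmund_zero β, rfl⟩ ?_
  rintro _ ⟨K, hK, rfl⟩
  refine h K hK _ (opNorm_nonneg 1 β _ u φ K) fun f hf hf1 => le_csSup ?_ ⟨f, hf, hf1, rfl⟩
  obtain ⟨C, hC0, hC⟩ := hb.2
  obtain ⟨C', hC'⟩ := hK.2.2.1
  refine ⟨C + |C'|, ?_⟩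
  rintro _ ⟨g, hg, hg1, rfl⟩
  have h1 := hC g hg
  have h2 := hC' g hg
  have h3 := zygNorm_sub_le (hb.1 g hg) (hK.2.1 g hg)
  have h0 := blochNorm_nonneg 1 g
  have h4 : C * blochNorm 1 g ≤ C * 1 := by gcongr
  have h5 : C' * blochNorm 1 g ≤ |C'| * 1 :=
    mul_le_mul (le_abs_self _) hg1 h0 (abs_nonneg _)
  linarith

lemma zygNorm_wcomp_le {β M Q s η : ℝ} {u φ G : ℂ → ℂ}
    (hu : DifferentiableOn ℂ u unitDisk) (hφ : DifferentiableOn ℂ φ unitDisk)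
    (hmaps : Set.MapsTo φ unitDisk unitDisk) (hQ : 0 ≤ Q) (hη : 0 ≤ η) (hM0 : 0 ≤ M)
    (hM : ∀ z : ℂ, ‖z‖ < 1 → (1 - ‖z‖ ^ 2) ^ β * ‖deriv (deriv u) z‖ ≤ M ∧
      (1 - ‖z‖ ^ 2) ^ β * ‖2 * deriv u z * deriv φ z + u z * deriv (deriv φ) z‖ ≤ M ∧
      (1 - ‖z‖ ^ 2) ^ β * ‖u z * deriv φ z ^ 2‖ ≤ M)
    (h : ∀ z : ℂ, ‖z‖ < 1 → s < ‖φ z‖ →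
      (1 - ‖z‖ ^ 2) ^ β * ‖deriv (deriv u) z‖ * logGrowth ‖φ z‖ ≤ 8 * Q ∧
      (1 - ‖z‖ ^ 2) ^ β * ‖2 * deriv u z * deriv φ z + u z * deriv (deriv φ) z‖ ≤
        4 * Q * (1 - ‖φ z‖) ∧
      (1 - ‖z‖ ^ 2) ^ β * ‖u z * deriv φ z ^ 2‖ ≤ 8 * Q * (1 - ‖φ z‖) ^ 2)
    (hG : MemBloch 1 G) (hG3 : blochNorm 1 G ≤ 3) (hs : ‖φ 0‖ ≤ s)
    (hGη : ∀ w : ℂ, ‖w‖ ≤ s → ‖G w‖ ≤ η ∧ ‖deriv G w‖ ≤ η ∧ ‖deriv (deriv G) w‖ ≤ η) :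
    zygNorm β (wcomp u φ G) ≤
      132 * Q + (‖u 0‖ + ‖deriv u 0‖ + ‖u 0‖ * ‖deriv φ 0‖ + 3 * M) * η := by
  obtain ⟨g0, g1, -⟩ := hGη (φ 0) hs
  have e0 : ‖wcomp u φ G 0‖ ≤ ‖u 0‖ * η := by
    rw [wcomp, norm_mul]
    gcongr
  have e1 : ‖deriv (wcomp u φ G) 0‖ ≤ ‖deriv u 0‖ * η + ‖u 0‖ * (η * ‖deriv φ 0‖) := by
    rw [deriv_wcomp hu hφ hmaps hG.1 (by simp)]
    refine (norm_add_le _ _).trans ?_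
    rw [norm_mul, norm_mul, norm_mul]
    gcongr
  have e2 : wnorm β (deriv (deriv (wcomp u φ G))) ≤ 132 * Q + 3 * M * η := by
    refine wnorm_le_of_forall fun z hz => ?_
    obtain ⟨mA, mB, mD⟩ := hM z hz
    have hW := weight_pos β hz
    have ha : ‖φ z‖ < 1 := mem_unitDisk.1 (hmaps (mem_unitDisk.2 hz))
    rw [deriv_deriv_wcomp hu hφ hmaps hG.1 hz]
    set D := u z * deriv φ z ^ 2
    set B := 2 * deriv u z * deriv φ z + u z * deriv (deriv φ) z
    set A := deriv (deriv u) z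
    set W := (1 - ‖z‖ ^ 2) ^ β
    have tri : W * ‖A * G (φ z) + B * deriv G (φ z) + D * deriv (deriv G) (φ z)‖ ≤
        W * ‖A‖ * ‖G (φ z)‖ + W * ‖B‖ * ‖deriv G (φ z)‖ +
          W * ‖D‖ * ‖deriv (deriv G) (φ z)‖ := by
      calc _ ≤ W * (‖A * G (φ z)‖ + ‖B * deriv G (φ z)‖ + ‖D * deriv (deriv G) (φ z)‖) := by
            gcongr
            exact norm_add₃_le
        _ = _ := by
            rw [norm_mul, norm_mul, norm_mul]
            ring
    refine tri.trans ?_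
    by_cases hsz : s < ‖φ z‖
    · obtain ⟨hA, hB, hD⟩ := h z hz hsz
      have hδ : 0 < 1 - ‖φ z‖ := by linarith
      have hL : 0 ≤ logGrowth ‖φ z‖ := zero_le_one.trans (one_le_logGrowth (norm_nonneg _) ha)
      have k0 : ‖G (φ z)‖ ≤ 3 * logGrowth ‖φ z‖ :=
        (hG.norm_le ha).trans (mul_le_mul_of_nonneg_right hG3 hL)
      have k1 := (hG.norm_deriv_le ha).trans (div_le_div_of_nonneg_right hG3 hδ.le)
      have k2 := (hG.norm_deriv_deriv_le ha).trans
        (div_le_div_of_nonneg_right (mul_le_mul_of_nonneg_left hG3 zero_le_four) (sq_nonneg _))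
      have p0 : W * ‖A‖ * ‖G (φ z)‖ ≤ 24 * Q :=
        calc W * ‖A‖ * ‖G (φ z)‖ ≤ W * ‖A‖ * (3 * logGrowth ‖φ z‖) := by gcongr
          _ = 3 * (W * ‖A‖ * logGrowth ‖φ z‖) := by ring
          _ ≤ 24 * Q := by linarith
      have p1 : W * ‖B‖ * ‖deriv G (φ z)‖ ≤ 12 * Q :=
        calc W * ‖B‖ * ‖deriv G (φ z)‖ ≤ (4 * Q * (1 - ‖φ z‖)) * (3 / (1 - ‖φ z‖)) :=
              mul_le_mul hB k1 (norm_nonneg _) (by positivity)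
          _ = 12 * Q := by field_simp; ring
      have p2 : W * ‖D‖ * ‖deriv (deriv G) (φ z)‖ ≤ 96 * Q :=
        calc W * ‖D‖ * ‖deriv (deriv G) (φ z)‖ ≤
              (8 * Q * (1 - ‖φ z‖) ^ 2) * (4 * 3 / (1 - ‖φ z‖) ^ 2) :=
              mul_le_mul hD k2 (norm_nonneg _) (by positivity)
          _ = 96 * Q := by field_simp; ring
      have : 0 ≤ 3 * M * η := by positivity
      linarith
    · obtain ⟨q0, q1, q2⟩ := hGη (φ z) (not_lt.1 hsz)
      have p0 := mul_le_mul mA q0 (norm_nonneg _) hM0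
      have p1 := mul_le_mul mB q1 (norm_nonneg _) hM0
      have p2 := mul_le_mul mD q2 (norm_nonneg _) hM0
      linarith
  rw [zygNorm]
  linarith

/-- Bounds for the three weighted sequences bound the essential norm from above. -/
lemma essNormZ_le_of_eventually {β Q : ℝ} {u φ : ℂ → ℂ}
    (hu : DifferentiableOn ℂ u unitDisk) (hφ : DifferentiableOn ℂ φ unitDisk)
    (hmaps : Set.MapsTo φ unitDisk unitDisk) (hb : BoundedBlochToZygmund 1 β u φ) (hQ : 0 ≤ Q)
    (hB : ∀ᶠ n : ℕ in atTop, ((n : ℝ) + 1) * wnorm β (fun z =>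
      (2 * deriv u z * deriv φ z + u z * deriv (deriv φ) z) * φ z ^ n) ≤ Q)
    (hD : ∀ᶠ n : ℕ in atTop, ((n : ℝ) + 1) ^ 2 * wnorm β (fun z =>
      u z * deriv φ z ^ 2 * φ z ^ n) ≤ Q)
    (hA : ∀ᶠ n : ℕ in atTop, Real.log n * wnorm β (fun z => deriv (deriv u) z * φ z ^ n) ≤ Q) :
    essNormZ 1 β (MemBloch 1) u φ ≤ 132 * Q := by
  obtain ⟨M, hM0, hM⟩ := exists_forall_weighted_coeff_le hu hφ hmaps hb
  obtain ⟨s, hs1, hs0, H⟩ := exists_forall_weighted_coeffs_le_of_eventually hmaps hM hB hD hA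
  have h0 : ‖φ 0‖ < 1 := mem_unitDisk.1 (hmaps (mem_unitDisk.2 (by simp)))
  refine le_of_forall_pos_le_add fun ε hε => ?_
  set C := ‖u 0‖ + ‖deriv u 0‖ + ‖u 0‖ * ‖deriv φ 0‖ + 3 * M with hC
  have hC0 : 0 ≤ C := by positivity
  obtain ⟨r, N, hrN⟩ := exists_dilated_taylor_approx (s := max s ‖φ 0‖) (η := ε / (1 + C))
    (hs0.trans (le_max_left _ _)) (max_lt hs1 h0) (by positivity)
  refine essNormZ_le_of_forall (isCompactOpToZygmund_taylor hb r N) fun f hf hf1 => ?_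
  obtain ⟨hG, hG3, hGη⟩ := hrN f hf hf1
  rw [wcomp_sub_taylor]
  refine (zygNorm_wcomp_le hu hφ hmaps hQ (by positivity) hM0 hM
    (fun z hz hsz => H z hz ((le_max_left _ _).trans_lt hsz)) hG hG3 (le_max_right _ _)
    hGη).trans ?_
  rw [← hC, mul_div_assoc', add_le_add_iff_left, div_le_iff₀ (by positivity)]
  nlinarith

lemma isCoboundedUnder_mul_wnorm {β : ℝ} {w : ℕ → ℝ} (hw : ∀ n, 0 ≤ w n) (g : ℕ → ℂ → ℂ) :
    IsCoboundedUnder (· ≤ ·) atTop (fun n => w n * wnorm β (g n)) :=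
  isCoboundedUnder_le_of_le atTop fun n => mul_nonneg (hw n) (wnorm_nonneg β _)

/-- **Theorem 4.5** (sequential form). For `uC_φ : B → Z_β` bounded, `‖uC_φ‖_e` is
comparable with the maximum of the three sequential limsup quantities (the last with a
logarithmic factor), with constants depending only on `β`. -/
theorem essNorm_Bloch_to_Zygmund_of_eq_one
    (β : ℝ) (hβ : 0 < β) :
    ∃ c C : ℝ, 0 < c ∧ 0 < C ∧
      ∀ u φ : ℂ → ℂ, DifferentiableOn ℂ u unitDisk → DifferentiableOn ℂ φ unitDisk →
        Set.MapsTo φ unitDisk unitDisk → BoundedBlochToZygmund 1 β u φ →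
        c * max
              (max
                (Filter.limsup
                  (fun n : ℕ => ((n : ℝ) + 1) * wnorm β (fun z => (2 * deriv u z * deriv φ z + u z * deriv (deriv φ) z) * φ z ^ n)) Filter.atTop)
                (Filter.limsup
                  (fun n : ℕ => ((n : ℝ) + 1) ^ 2 * wnorm β (fun z => u z * deriv φ z ^ 2 * φ z ^ n)) Filter.atTop))
              (Filter.limsup
                (fun n : ℕ => Real.log n * wnorm β (fun z => deriv (deriv u) z * φ z ^ n)) Filter.atTop)
            ≤ essNormZ 1 β (MemBloch 1) u φ ∧
          essNormZ 1 β (MemBloch 1) u φ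
            ≤ C * max
                (max
                  (Filter.limsup
                    (fun n : ℕ => ((n : ℝ) + 1) * wnorm β (fun z => (2 * deriv u z * deriv φ z + u z * deriv (deriv φ) z) * φ z ^ n)) Filter.atTop)
                  (Filter.limsup
                    (fun n : ℕ => ((n : ℝ) + 1) ^ 2 * wnorm β (fun z => u z * deriv φ z ^ 2 * φ z ^ n)) Filter.atTop))
                (Filter.limsup
                  (fun n : ℕ => Real.log n * wnorm β (fun z => deriv (deriv u) z * φ z ^ n)) Filter.atTop) := by
  refine ⟨1 / 100000000000, 132, by norm_num, by norm_num, fun u φ hu hφ hmaps hb => ?_⟩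
  have cB := isCoboundedUnder_mul_wnorm (β := β) (w := fun n : ℕ => (n : ℝ) + 1)
    (fun n => by positivity)
    fun n z => (2 * deriv u z * deriv φ z + u z * deriv (deriv φ) z) * φ z ^ n
  have cD := isCoboundedUnder_mul_wnorm (β := β) (w := fun n : ℕ => ((n : ℝ) + 1) ^ 2)
    (fun n => by positivity) fun n z => u z * deriv φ z ^ 2 * φ z ^ n
  have cA := isCoboundedUnder_mul_wnorm (β := β) (w := fun n : ℕ => Real.log n)
    (fun n => Real.log_natCast_nonneg n) fun n z => deriv (deriv u) z * φ z ^ n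
  constructor
  · refine le_essNormZ hb fun K hK S hS0 hS => ?_
    set M : ℝ := max (max _ _) _
    have key : ∀ ε > 0, M ≤ 100000000000 * S + ε := fun ε hε => by
      have h := eventually_sequences_le hu hφ hmaps hb hK hS0 hS hε
      exact max_le (max_le (limsup_le_of_le cB (h.mono fun n hn => hn.1))
        (limsup_le_of_le cD (h.mono fun n hn => hn.2.1)))
        (limsup_le_of_le cA (h.mono fun n hn => hn.2.2))
    have := le_of_forall_pos_le_add key
    linarith
  · obtain ⟨C, hC0, hC⟩ := hb.2
    have hbd := eventually_sequences_le hu hφ hmaps hb (isCompactOpToZygmund_zero β) hC0.le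
      (fun f hf hf1 => by
        simp only [sub_zero]
        exact (hC f hf).trans (mul_le_of_le_one_right hC0.le hf1)) one_pos
    refine le_of_forall_pos_le_add fun ε hε => ?_
    set M : ℝ := max (max _ _) _
    have hlt : M < M + ε / 132 := by
      have : 0 < ε / 132 := by positivity
      linarith
    have eB := eventually_lt_of_limsup_lt
      (((le_max_left _ _).trans (le_max_left _ _)).trans_lt hlt)
      (isBoundedUnder_of_eventually_le (hbd.mono fun n hn => hn.1))
    have eD := eventually_lt_of_limsup_lt
      (((le_max_right _ _).trans (le_max_left _ _)).trans_lt hlt)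
      (isBoundedUnder_of_eventually_le (hbd.mono fun n hn => hn.2.1))
    have eA := eventually_lt_of_limsup_lt ((le_max_right _ _).trans_lt hlt)
      (isBoundedUnder_of_eventually_le (hbd.mono fun n hn => hn.2.2))
    obtain ⟨n, hn⟩ := eB.exists
    have hQ : 0 ≤ M + ε / 132 :=
      (mul_nonneg (by positivity) (wnorm_nonneg β _)).trans hn.le
    have := essNormZ_le_of_eventually hu hφ hmaps hb hQ (eB.mono fun _ h => h.le)
      (eD.mono fun _ h => h.le) (eA.mono fun _ h => h.le)
    linarith

end
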